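/- arXiv:2003.01165 — 3 statements merged into one kernel-verified Lean document; each statement's English description precedes it below -/
import Mathlib

section
/- Let n ≥ 1, let f ∈ BV(ℝⁿ), and let ρ : (0,∞) → [0,∞) be a measurable function with ∫_{ℝⁿ} ρ(|x|) dx = 1. Then ∬_{ℝⁿ×ℝⁿ} (|f(x) − f(y)| / |x−y|) ρ(|x−y|) dx dy ≤ 𝐊_{1,n} ∫_{ℝⁿ} |Df|, where ∫_{ℝⁿ} |Df| is the total variation of f and 𝐊_{1,n} := ⨍_{S^{n−1}} |e·x| dH^{n−1}(x). -/
open MeasureTheory Metric Filter Asymptotics ENNReal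
open scoped ENNReal NNReal Topology

noncomputable section

abbrev V (n : ℕ) := EuclideanSpace ℝ (Fin n)

/-- Divergence of a vector field on `ℝⁿ`. -/
def vdiv {n : ℕ} (φ : V n → V n) (x : V n) : ℝ :=
  ∑ i : Fin n, fderiv ℝ φ x (EuclideanSpace.single i 1) i

/-- The perimeter of a set in `ℝⁿ` (the total variation of its indicator function),
defined by duality against compactly supported `C¹` vector fields bounded by `1`. -/
def perimeter {n : ℕ} (E : Set (V n)) : ℝ≥0∞ :=
  ⨆ φ : {φ : V n → V n // ContDiff ℝ 1 φ ∧ HasCompactSupport φ ∧ ∀ x, ‖φ x‖ ≤ 1},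
    ENNReal.ofReal (∫ x in E, vdiv φ.1 x)

/-- A set of finite perimeter. -/
def HasFinitePerimeter {n : ℕ} (E : Set (V n)) : Prop :=
  MeasurableSet E ∧ perimeter E < ⊤

/-- Real-valued perimeter `P(E)`. -/
def P {n : ℕ} (E : Set (V n)) : ℝ := (perimeter E).toReal

/-- The constant `𝐄_{p,n}`: the average over the unit sphere `S^{n-1} ⊆ ℝⁿ` of
`|e·x|^p` (with respect to the `(n-1)`-dimensional Hausdorff measure), for the
unit vector `e = e₀`. -/
def Kconst (n : ℕ) (p : ℝ) : ℝ :=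
  if h : n = 0 then 0 else
    ⨍ x in sphere (0 : V n) 1, |x ⟨0, Nat.pos_of_ne_zero h⟩| ^ p ∂ μH[(n : ℝ) - 1]


/-- The total variation of a function `f : ℝⁿ → ℝ`, by duality against compactly
supported `C¹` vector fields bounded by `1`. -/
def totalVar {n : ℕ} (f : V n → ℝ) : ℝ≥0∞ :=
  ⨆ φ : {φ : V n → V n // ContDiff ℝ 1 φ ∧ HasCompactSupport φ ∧ ∀ x, ‖φ x‖ ≤ 1},
    ENNReal.ofReal (∫ x : V n, f x * vdiv φ.1 x)

lemma aux_normalize_lip {E : Type*} [NormedAddCommGroup E] [NormedSpace ℝ E] :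
    LipschitzOnWith 2 (fun x : E => ‖x‖⁻¹ • x) {x | 1 ≤ ‖x‖} := by
  refine LipschitzOnWith.of_dist_le_mul ?_
  intro x hx y hy
  simp only [Set.mem_ofPred_eq] at hx hy
  have hx0 : 0 < ‖x‖ := by linarith
  have hy0 : 0 < ‖y‖ := by linarith
  rw [dist_eq_norm, dist_eq_norm]
  have e : ‖x‖⁻¹ • x - ‖y‖⁻¹ • y = ‖x‖⁻¹ • ((x - y) + ((‖y‖ - ‖x‖) * ‖y‖⁻¹) • y) := by
    rw [sub_mul, sub_smul, mul_inv_cancel₀ hy0.ne', one_smul, smul_add, smul_sub, smul_sub,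
      smul_smul, ← mul_assoc, inv_mul_cancel₀ hx0.ne', one_mul]
    abel
  rw [e, norm_smul, norm_inv, norm_norm]
  have h1 : ‖(x - y) + ((‖y‖ - ‖x‖) * ‖y‖⁻¹) • y‖ ≤ 2 * ‖x - y‖ := by
    refine (norm_add_le _ _).trans ?_
    rw [norm_smul, norm_mul, norm_inv, norm_norm, mul_assoc, inv_mul_cancel₀ hy0.ne', mul_one]
    have := abs_norm_sub_norm_le y x
    rw [norm_sub_rev] at this
    rw [Real.norm_eq_abs]
    linarith
  have h2 : ‖x‖⁻¹ ≤ 1 := inv_le_one_of_one_le₀ hx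
  calc _ ≤ 1 * (2 * ‖x - y‖) := by gcongr
    _ = _ := by simp

lemma aux_sphere_lt_top (m : ℕ) :
    (μH[(m : ℝ)] : Measure (V (m + 1))) (sphere (0 : V (m + 1)) 1) < ⊤ := by
  let F : Fin (m + 1) → ℝ → (Fin m → ℝ) → V (m + 1) :=
    fun i s y => WithLp.toLp 2 (Fin.insertNth (α := fun _ => ℝ) i s y)
  let N : V (m + 1) → V (m + 1) := fun x => ‖x‖⁻¹ • x
  have hF1 : ∀ i s y, |s| ≤ ‖F i s y‖ := by
    intro i s y
    have := PiLp.norm_apply_le (F i s y) i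
    simpa [F] using this
  have hFl : ∀ i s, ∃ K, LipschitzWith K (F i s) := by
    intro i s
    refine ⟨_, (PiLp.lipschitzWith_toLp 2 (fun _ : Fin (m + 1) => ℝ)).comp
      (g := fun y => Fin.insertNth (α := fun _ => ℝ) i s y) (Kg := 1) ?_⟩
    refine LipschitzWith.of_dist_le_mul fun x y => ?_
    simp only [NNReal.coe_one, one_mul]
    rw [dist_pi_le_iff dist_nonneg]
    intro j
    refine Fin.succAboveCases i ?_ (fun k => ?_) j
    · simp
    · simpa using dist_le_pi_dist x y k
  have hsub : sphere (0 : V (m + 1)) 1 ⊆ ⋃ i : Fin (m + 1),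
      ((N ∘ F i 1) '' closedBall 0 1 ∪ (N ∘ F i (-1)) '' closedBall 0 1) := by
    intro x hx
    have hx1 : ‖x‖ = 1 := by simpa using hx
    obtain ⟨i, -, hi⟩ := Finset.exists_max_image Finset.univ (fun i => |x i|) ⟨0, by simp⟩
    have hi0 : 0 < |x i| := by
      by_contra h
      have h0 : |x i| = 0 := le_antisymm (not_lt.1 h) (abs_nonneg _)
      have : x = 0 := by
        ext j
        have := hi j (Finset.mem_univ _)
        rw [h0] at this
        simpa using this
      simp [this] at hx1
    have hy : ∀ c : ℝ, 0 < c → |x i| = c⁻¹ → ∀ s : ℝ, c * x i = s →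
        x ∈ (N ∘ F i s) '' closedBall 0 1 := by
      intro c hc hxc s hs
      refine ⟨fun k => c * x (i.succAbove k), ?_, ?_⟩
      · rw [mem_closedBall_zero_iff, pi_norm_le_iff_of_nonneg zero_le_one]
        intro k
        have := hi (i.succAbove k) (Finset.mem_univ _)
        simp only [hxc] at this
        rw [norm_mul, Real.norm_eq_abs, Real.norm_eq_abs, abs_of_pos hc]
        calc _ ≤ c * c⁻¹ := by gcongr
          _ = 1 := mul_inv_cancel₀ hc.ne'
      · have : F i s (fun k => c * x (i.succAbove k)) = c • x := by
          ext j
          refine Fin.succAboveCases i ?_ (fun k => ?_) j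
          · simp [F, hs]
          · simp [F]
        simp only [Function.comp, this, N]
        rw [norm_smul, hx1, mul_one, Real.norm_eq_abs, abs_of_pos hc, smul_smul,
          inv_mul_cancel₀ hc.ne', one_smul]
    refine Set.mem_iUnion.2 ⟨i, ?_⟩
    rcases lt_or_ge 0 (x i) with h | h
    · left
      exact hy (x i)⁻¹ (inv_pos.2 h) (by rw [inv_inv, abs_of_pos h]) 1 (inv_mul_cancel₀ h.ne')
    · have h' : x i < 0 := lt_of_le_of_ne h (abs_pos.1 hi0)
      right
      refine hy (-(x i))⁻¹ (inv_pos.2 (by linarith)) (by rw [inv_inv, abs_of_neg h']) (-1) ?_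
      rw [inv_neg, neg_mul, inv_mul_cancel₀ h'.ne]
  have hball : (μH[(m : ℝ)] : Measure (Fin m → ℝ)) (closedBall 0 1) < ⊤ := by
    have := hausdorffMeasure_pi_real (ι := Fin m)
    rw [Fintype.card_fin] at this
    rw [this]
    exact measure_closedBall_lt_top
  have him : ∀ i s, |s| = 1 → (μH[(m : ℝ)] : Measure (V (m + 1)))
      ((N ∘ F i s) '' closedBall 0 1) < ⊤ := by
    intro i s hs
    obtain ⟨K, hK⟩ := hFl i s
    have hL : LipschitzOnWith (2 * K) (N ∘ F i s) (closedBall 0 1) := by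
      refine aux_normalize_lip.comp hK.lipschitzOnWith ?_
      intro y _
      have := hF1 i s y
      rw [hs] at this
      exact this
    refine (hL.hausdorffMeasure_image_le (Nat.cast_nonneg m)).trans_lt ?_
    refine ENNReal.mul_lt_top ?_ hball
    exact ENNReal.rpow_lt_top_of_nonneg (Nat.cast_nonneg m) ENNReal.coe_ne_top
  refine (measure_mono hsub).trans_lt ?_
  refine (measure_iUnion_le _).trans_lt ?_
  rw [tsum_fintype]
  refine ENNReal.sum_lt_top.2 fun i _ => ?_
  exact (measure_union_le _ _).trans_lt
    (ENNReal.add_lt_top.2 ⟨him i 1 (by simp), him i (-1) (by simp)⟩)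

lemma aux_sphere_pos (m : ℕ) :
    0 < (μH[(m : ℝ)] : Measure (V (m + 1))) (sphere (0 : V (m + 1)) 1) := by
  let π : V (m + 1) → (Fin m → ℝ) := fun x k => x k.succ
  have hL : LipschitzWith 1 π := by
    refine LipschitzWith.of_dist_le_mul fun x y => ?_
    simp only [NNReal.coe_one, one_mul]
    rw [dist_pi_le_iff dist_nonneg]
    intro j
    have := PiLp.norm_apply_le (x - y) j.succ
    rw [dist_eq_norm, dist_eq_norm]
    simpa [π] using this
  have h0 : (0 : ℝ) < ((m : ℝ) + 1)⁻¹ := by positivity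
  have hsub : ball (0 : Fin m → ℝ) ((m : ℝ) + 1)⁻¹ ⊆ π '' sphere 0 1 := by
    intro y hy
    have hy' : ∀ k, |y k| ≤ ((m : ℝ) + 1)⁻¹ := fun k =>
      (norm_le_pi_norm y k).trans (mem_ball_zero_iff.1 hy).le
    have hs : ∑ k, y k ^ 2 ≤ 1 := by
      calc ∑ k, y k ^ 2 ≤ ∑ k : Fin m, ((m : ℝ) + 1)⁻¹ := by
            refine Finset.sum_le_sum fun k _ => ?_
            have h1 := hy' k
            have h2 : ((m : ℝ) + 1)⁻¹ ≤ 1 := inv_le_one_of_one_le₀ (by linarith [Nat.cast_nonneg (α := ℝ) m])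
            rw [← sq_abs]
            nlinarith [abs_nonneg (y k)]
        _ = m * ((m : ℝ) + 1)⁻¹ := by simp
        _ ≤ 1 := by
            rw [← div_eq_mul_inv, div_le_one (by positivity)]; linarith
    refine ⟨WithLp.toLp 2 (Fin.cons (α := fun _ => ℝ) (√(1 - ∑ k, y k ^ 2)) y), ?_, ?_⟩
    · rw [mem_sphere_zero_iff_norm, EuclideanSpace.norm_eq, Real.sqrt_eq_one, Fin.sum_univ_succ]
      simp only [Fin.cons_zero, Fin.cons_succ, Real.norm_eq_abs, sq_abs]
      rw [Real.sq_sqrt (by linarith)]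
      ring
    · ext k; simp [π]
  have hpos : 0 < (μH[(m : ℝ)] : Measure (Fin m → ℝ)) (ball 0 ((m : ℝ) + 1)⁻¹) := by
    have := hausdorffMeasure_pi_real (ι := Fin m)
    rw [Fintype.card_fin] at this
    rw [this]
    exact measure_ball_pos _ _ h0
  refine hpos.trans_le ((measure_mono hsub).trans ?_)
  simpa using hL.hausdorffMeasure_image_le (Nat.cast_nonneg m) (sphere 0 1)

lemma aux_exists_isom {n : ℕ} (v w : V n) (h : ‖v‖ = ‖w‖) :
    ∃ L : V n ≃ₗᵢ[ℝ] V n, L v = w := ⟨_, Submodule.reflection_sub h⟩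

/-- rotation invariant averages of `|⟪v, h⟫|` are multiples of `‖v‖`. -/
lemma aux_rot {n : ℕ} (μ : Measure (V n)) (hμ : ∀ L : V n ≃ₗᵢ[ℝ] V n, MeasurePreserving L μ μ)
    (w : V n → ℝ≥0∞) (hw : Measurable w) (hwL : ∀ (L : V n ≃ₗᵢ[ℝ] V n) h, w (L h) = w h)
    (e : V n) (he : ‖e‖ = 1) (v : V n) :
    ∫⁻ h, w h * ‖inner ℝ v h‖ₑ ∂μ = ‖v‖ₑ * ∫⁻ h, w h * ‖inner ℝ e h‖ₑ ∂μ := by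
  obtain ⟨L, hL⟩ := aux_exists_isom (‖v‖ • e) v (by simp [norm_smul, he])
  have h1 := (hμ L).lintegral_comp_emb L.toHomeomorph.measurableEmbedding
    (fun h => w h * ‖inner ℝ v h‖ₑ)
  rw [← h1, ← lintegral_const_mul _ (by fun_prop)]
  refine lintegral_congr fun h => ?_
  rw [hwL]
  have : inner ℝ v (L h) = ‖v‖ * inner ℝ e h := by
    conv_lhs => rw [← hL]
    rw [LinearIsometryEquiv.inner_map_map, inner_smul_left]
    simp
  rw [this, enorm_mul, enorm_norm]
  ring

lemma aux_const (m : ℕ) (ρ : ℝ → ℝ) (hρm : Measurable ρ) (hρ0 : ∀ r : ℝ, 0 < r → 0 ≤ ρ r)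
    (hρ1 : ∫ x : V (m + 1), ρ ‖x‖ = 1) (v : V (m + 1)) :
    ∫⁻ h : V (m + 1), ENNReal.ofReal (ρ ‖h‖ / ‖h‖) * ‖inner ℝ v h‖ₑ
      = ENNReal.ofReal (Kconst (m + 1) 1) * ‖v‖ₑ := by
  set S : Set (V (m + 1)) := sphere 0 1 with hS
  set σ : Measure (V (m + 1)) := (μH[(m : ℝ)] : Measure (V (m + 1))).restrict S with hσ
  have hSt : (μH[(m : ℝ)] : Measure (V (m + 1))) S < ⊤ := aux_sphere_lt_top m
  have hSp : 0 < (μH[(m : ℝ)] : Measure (V (m + 1))) S := aux_sphere_pos m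
  have hSm : MeasurableSet S := isClosed_sphere.measurableSet
  have : IsFiniteMeasure σ := ⟨by rw [hσ, Measure.restrict_apply_univ]; exact hSt⟩
  have hσL : ∀ L : V (m + 1) ≃ₗᵢ[ℝ] V (m + 1), MeasurePreserving L σ σ := by
    intro L
    have h := (L.toIsometryEquiv.measurePreserving_hausdorffMeasure (m : ℝ)).restrict_preimage hSm
    have hpre : L.toIsometryEquiv ⁻¹' S = S := by
      ext x; simp [hS]
    rw [hpre] at h
    exact h
  set e : V (m + 1) := EuclideanSpace.single 0 1 with he
  have hen : ‖e‖ = 1 := by simp [he]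
  set w : V (m + 1) → ℝ≥0∞ := fun h => ENNReal.ofReal (ρ ‖h‖ / ‖h‖) with hw
  have hwm : Measurable w := by
    refine ENNReal.measurable_ofReal.comp ?_
    exact (hρm.comp measurable_norm).div measurable_norm
  have hA := aux_rot volume (fun L => L.measurePreserving) w hwm (by simp [hw]) e hen
  have hB := aux_rot σ hσL (fun _ => 1) measurable_const (by simp) e hen
  simp only [one_mul] at hB
  set A := ∫⁻ h, w h * ‖inner ℝ e h‖ₑ with hAdef
  set B := ∫⁻ h, ‖inner ℝ e h‖ₑ ∂σ with hBdef
  have hρi : Integrable (fun x : V (m + 1) => ρ ‖x‖) := by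
    by_contra h
    rw [integral_undef h] at hρ1
    exact zero_ne_one hρ1
  have hne : ∀ᵐ x : V (m + 1), x ≠ 0 := by
    rw [ae_iff]; simp
  have hmass : ∫⁻ h : V (m + 1), w h * ‖h‖ₑ = 1 := by
    rw [← ENNReal.ofReal_one, ← hρ1, ofReal_integral_eq_lintegral_ofReal hρi]
    · refine lintegral_congr_ae ?_
      filter_upwards [hne] with x hx
      have hx0 : 0 < ‖x‖ := norm_pos_iff.2 hx
      rw [hw, ← ofReal_norm, ← ENNReal.ofReal_mul (div_nonneg (hρ0 _ hx0) hx0.le),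
        div_mul_cancel₀ _ hx0.ne']
    · filter_upwards [hne] with x hx
      exact hρ0 _ (norm_pos_iff.2 hx)
  have hswap : ∫⁻ h, ∫⁻ x, w h * ‖inner ℝ x h‖ₑ ∂σ = ∫⁻ x, ∫⁻ h, w h * ‖inner ℝ x h‖ₑ ∂volume ∂σ := by
    refine lintegral_lintegral_swap ?_
    refine Measurable.aemeasurable ?_
    refine (hwm.comp measurable_fst).mul ?_
    exact Continuous.measurable (by fun_prop)
  have h1 : ∫⁻ h, ∫⁻ x, w h * ‖inner ℝ x h‖ₑ ∂σ = B := by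
    have : ∀ h, ∫⁻ x, w h * ‖inner ℝ x h‖ₑ ∂σ = (w h * ‖h‖ₑ) * B := by
      intro h
      rw [lintegral_const_mul _ (by fun_prop), mul_assoc, ← hB]
      simp_rw [real_inner_comm]
    simp_rw [this]
    rw [lintegral_mul_const _ (by fun_prop), hmass, one_mul]
  have h2 : ∫⁻ x, ∫⁻ h, w h * ‖inner ℝ x h‖ₑ ∂volume ∂σ = A * (μH[(m : ℝ)] : Measure (V (m + 1))) S := by
    simp_rw [hA]
    have : ∀ᵐ x ∂σ, ‖x‖ₑ * A = A := by
      filter_upwards [ae_restrict_mem hSm] with x hx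
      have : ‖x‖ = 1 := by simpa [hS] using hx
      rw [← ofReal_norm, this]; simp
    rw [lintegral_congr_ae this, lintegral_const, hσ, Measure.restrict_apply_univ]
  have hK : ENNReal.ofReal (Kconst (m + 1) 1) = B / (μH[(m : ℝ)] : Measure (V (m + 1))) S := by
    have hd : ((m + 1 : ℕ) : ℝ) - 1 = m := by push_cast; ring
    unfold Kconst
    rw [dif_neg (Nat.succ_ne_zero m), hd, average_eq, smul_eq_mul, ENNReal.ofReal_mul (by positivity)]
    have hintg : Integrable (fun x : V (m + 1) => |x ⟨0, Nat.pos_of_ne_zero (Nat.succ_ne_zero m)⟩| ^ (1 : ℝ)) σ := by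
      refine Integrable.of_bound (Measurable.aestronglyMeasurable ?_) 1 ?_
      · simp only [Real.rpow_one]
        exact Continuous.measurable (by fun_prop)
      · filter_upwards [ae_restrict_mem hSm] with x hx
        have hx : ‖x‖ = 1 := by simpa [hS] using hx
        have := PiLp.norm_apply_le x ⟨0, Nat.pos_of_ne_zero (Nat.succ_ne_zero m)⟩
        rw [hx] at this
        simpa using this
    rw [ofReal_integral_eq_lintegral_ofReal hintg (ae_of_all _ fun x => by positivity)]
    rw [mul_comm, ENNReal.div_eq_inv_mul, mul_comm]
    congr 1
    · rw [Measure.real, Measure.restrict_apply_univ, ENNReal.ofReal_inv_of_pos, ENNReal.ofReal_toReal hSt.ne]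
      exact ENNReal.toReal_pos hSp.ne' hSt.ne
    · refine lintegral_congr fun x => ?_
      rw [Real.rpow_one, he, EuclideanSpace.inner_single_left, ← ofReal_norm]
      simp
  rw [hA, hK, mul_comm]
  congr 1
  rw [ENNReal.eq_div_iff hSp.ne' hSt.ne, mul_comm, ← h2, ← hswap, h1]

lemma aux_transl {n : ℕ} (g : V n → ℝ) (hg : ContDiff ℝ 1 g) (h : V n) :
    ∫⁻ x, ‖g x - g (x - h)‖ₑ ≤ ∫⁻ x, ‖fderiv ℝ g x h‖ₑ := by
  have hc : Continuous (fderiv ℝ g) := hg.continuous_fderiv one_ne_zero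
  have h1 : ∀ x, ‖g x - g (x - h)‖ₑ ≤ ∫⁻ t in Set.Ioc (0 : ℝ) 1, ‖fderiv ℝ g (x - t • h) h‖ₑ := by
    intro x
    have hd : ∀ t ∈ Set.uIcc (0 : ℝ) 1,
        HasDerivAt (fun t : ℝ => g (x - t • h)) (-(fderiv ℝ g (x - t • h) h)) t := by
      intro t _
      have h2 : HasDerivAt (fun t : ℝ => x - t • h) (-h) t := by
        simpa using ((hasDerivAt_id t).smul_const h).const_sub x
      have h3 := ((hg.differentiable one_ne_zero) (x - t • h)).hasFDerivAt.comp_hasDerivAt t h2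
      rw [map_neg] at h3
      exact h3
    have hintg := intervalIntegral.integral_eq_sub_of_hasDerivAt hd
      (Continuous.intervalIntegrable (by fun_prop) _ _)
    have h4 : g x - g (x - h) = ∫ t in (0 : ℝ)..1, fderiv ℝ g (x - t • h) h := by
      rw [intervalIntegral.integral_neg] at hintg
      simp at hintg
      linarith
    rw [h4, intervalIntegral.integral_of_le zero_le_one]
    exact enorm_integral_le_lintegral_enorm _
  calc ∫⁻ x, ‖g x - g (x - h)‖ₑ
      ≤ ∫⁻ x, ∫⁻ t in Set.Ioc (0 : ℝ) 1, ‖fderiv ℝ g (x - t • h) h‖ₑ := lintegral_mono h1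
    _ = ∫⁻ t in Set.Ioc (0 : ℝ) 1, ∫⁻ x, ‖fderiv ℝ g (x - t • h) h‖ₑ := by
        refine lintegral_lintegral_swap ?_
        refine Measurable.aemeasurable (Continuous.measurable ?_)
        unfold Function.uncurry
        fun_prop
    _ = ∫⁻ t in Set.Ioc (0 : ℝ) 1, ∫⁻ x, ‖fderiv ℝ g x h‖ₑ := by
        refine lintegral_congr fun t => ?_
        exact lintegral_sub_right_eq_self (fun x => ‖fderiv ℝ g x h‖ₑ) (t • h)
    _ = _ := by simp

lemma aux_smooth (m : ℕ) (ρ : ℝ → ℝ) (hρm : Measurable ρ) (hρ0 : ∀ r : ℝ, 0 < r → 0 ≤ ρ r)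
    (hρ1 : ∫ x : V (m + 1), ρ ‖x‖ = 1) (g : V (m + 1) → ℝ) (hg : ContDiff ℝ 1 g) :
    ∫⁻ x : V (m + 1), ∫⁻ y : V (m + 1),
        ENNReal.ofReal (|g x - g y| / ‖x - y‖ * ρ ‖x - y‖)
      ≤ ENNReal.ofReal (Kconst (m + 1) 1) * ∫⁻ x, ‖fderiv ℝ g x‖ₑ := by
  have hc : Continuous (fderiv ℝ g) := hg.continuous_fderiv one_ne_zero
  have hg0 : Continuous g := hg.continuous
  set w : V (m + 1) → ℝ≥0∞ := fun h => ENNReal.ofReal (ρ ‖h‖ / ‖h‖) with hw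
  have hwm : Measurable w := by
    refine ENNReal.measurable_ofReal.comp ?_
    exact (hρm.comp measurable_norm).div measurable_norm
  calc ∫⁻ x : V (m + 1), ∫⁻ y : V (m + 1),
        ENNReal.ofReal (|g x - g y| / ‖x - y‖ * ρ ‖x - y‖)
      = ∫⁻ x : V (m + 1), ∫⁻ y : V (m + 1), w (x - y) * ‖g x - g (x - (x - y))‖ₑ := by
        refine lintegral_congr fun x => lintegral_congr fun y => ?_
        rw [_root_.sub_sub_cancel, ← ofReal_norm, Real.norm_eq_abs, mul_comm (w _), hw,
          ← ENNReal.ofReal_mul (abs_nonneg _)]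
        congr 1
        ring
    _ = ∫⁻ x : V (m + 1), ∫⁻ h : V (m + 1), w h * ‖g x - g (x - h)‖ₑ := by
        refine lintegral_congr fun x => ?_
        exact lintegral_sub_left_eq_self (fun h => w h * ‖g x - g (x - h)‖ₑ) x
    _ = ∫⁻ h : V (m + 1), ∫⁻ x : V (m + 1), w h * ‖g x - g (x - h)‖ₑ := by
        refine lintegral_lintegral_swap ?_
        refine Measurable.aemeasurable ?_
        refine (hwm.comp measurable_snd).mul ?_
        exact Continuous.measurable (by fun_prop)
    _ = ∫⁻ h : V (m + 1), w h * ∫⁻ x : V (m + 1), ‖g x - g (x - h)‖ₑ := by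
        refine lintegral_congr fun h => ?_
        exact lintegral_const_mul _ (Continuous.measurable (by fun_prop))
    _ ≤ ∫⁻ h : V (m + 1), w h * ∫⁻ x : V (m + 1), ‖fderiv ℝ g x h‖ₑ := by
        refine lintegral_mono fun h => ?_
        exact mul_le_mul_right (aux_transl g hg h) _
    _ = ∫⁻ h : V (m + 1), ∫⁻ x : V (m + 1), w h * ‖fderiv ℝ g x h‖ₑ := by
        refine lintegral_congr fun h => ?_
        exact (lintegral_const_mul _ (Continuous.measurable (by fun_prop))).symm
    _ = ∫⁻ x : V (m + 1), ∫⁻ h : V (m + 1), w h * ‖fderiv ℝ g x h‖ₑ := by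
        refine lintegral_lintegral_swap ?_
        refine Measurable.aemeasurable ?_
        refine (hwm.comp measurable_fst).mul ?_
        exact Continuous.measurable (by fun_prop)
    _ = ∫⁻ x : V (m + 1), ENNReal.ofReal (Kconst (m + 1) 1) * ‖fderiv ℝ g x‖ₑ := by
        refine lintegral_congr fun x => ?_
        have := aux_const m ρ hρm hρ0 hρ1 ((InnerProductSpace.toDual ℝ (V (m + 1))).symm (fderiv ℝ g x))
        simp only [InnerProductSpace.toDual_symm_apply] at this
        rw [this]
        congr 1
        rw [← ofReal_norm, ← ofReal_norm, LinearIsometryEquiv.norm_map]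
    _ = _ := lintegral_const_mul _ (Continuous.measurable (by fun_prop))

lemma aux_tv {n : ℕ} (f : V n → ℝ) (hf : Integrable f) (η : V n → ℝ) (hη : ContDiff ℝ 1 η)
    (hηc : HasCompactSupport η) (hη0 : ∀ x, 0 ≤ η x) (hη1 : ∫ x, η x = 1)
    (hηe : ∀ x, η (-x) = η x) :
    let g : V n → ℝ := fun x => ∫ t, f t * η (x - t)
    ContDiff ℝ 1 g ∧ ∫⁻ x, ‖fderiv ℝ g x‖ₑ ≤ totalVar f := by
  intro g
  have hgdef : g = convolution f η (ContinuousLinearMap.mul ℝ ℝ) volume := by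
    ext x; rfl
  have hDc : Continuous (fderiv ℝ η) := hη.continuous_fderiv one_ne_zero
  have hDs : HasCompactSupport (fderiv ℝ η) := hηc.fderiv ℝ
  obtain ⟨C, hC⟩ := hDs.exists_bound_of_continuous hDc
  have hDodd : ∀ x, fderiv ℝ η (-x) = - fderiv ℝ η x := by
    intro x
    have h : (fun x => η (-x)) = η := funext hηe
    have h3 := ((hη.differentiable one_ne_zero) (-x)).hasFDerivAt.comp x (hasFDerivAt_id x).neg
    have h2 : HasFDerivAt (fun x => η (-x)) (-fderiv ℝ η (-x)) x := by
      have e : (fderiv ℝ η (-x)).comp (-ContinuousLinearMap.id ℝ (V n)) = -fderiv ℝ η (-x) := by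
        ext v
        simp
      rw [← e]
      exact h3
    rw [h] at h2
    rw [h2.fderiv, neg_neg]
  have hgC : ContDiff ℝ 1 g := by
    rw [hgdef]
    exact hηc.contDiff_convolution_right _ hf.locallyIntegrable (by exact_mod_cast hη)
  have hgD : ∀ x v, fderiv ℝ g x v = ∫ t, f t * fderiv ℝ η (x - t) v := by
    intro x v
    rw [hgdef, (hηc.hasFDerivAt_convolution_right _ hf.locallyIntegrable hη x).fderiv,
      convolution_precompR_apply _ hf.locallyIntegrable hDs hDc]
    rfl
  refine ⟨hgC, ?_⟩
  have hGc : Continuous (fderiv ℝ g) := hgC.continuous_fderiv one_ne_zero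
  -- the unit field
  let u : V n → V n := fun x => ‖fderiv ℝ g x‖⁻¹ •
    (InnerProductSpace.toDual ℝ (V n)).symm (fderiv ℝ g x)
  have hum : Measurable u := by
    refine Measurable.smul hGc.norm.measurable.inv ?_
    exact ((InnerProductSpace.toDual ℝ (V n)).symm.continuous.comp hGc).measurable
  have hu1 : ∀ x, ‖u x‖ ≤ 1 := by
    intro x
    simp only [u, norm_smul, norm_inv, norm_norm, LinearIsometryEquiv.norm_map]
    exact inv_mul_le_one
  have huG : ∀ x, fderiv ℝ g x (u x) = ‖fderiv ℝ g x‖ := by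
    intro x
    by_cases h : fderiv ℝ g x = 0
    · simp [h]
    have h0 : ‖fderiv ℝ g x‖ ≠ 0 := norm_ne_zero_iff.2 h
    have h1 : fderiv ℝ g x ((InnerProductSpace.toDual ℝ (V n)).symm (fderiv ℝ g x)) =
        ‖fderiv ℝ g x‖ ^ 2 := by
      rw [← InnerProductSpace.toDual_symm_apply, real_inner_self_eq_norm_sq,
        LinearIsometryEquiv.norm_map]
    simp only [u, map_smul, h1, smul_eq_mul]
    field_simp
  have key : ∀ R : ℕ, ∫⁻ x in closedBall (0 : V n) R, ‖fderiv ℝ g x‖ₑ ≤ totalVar f := by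
    intro R
    set B : Set (V n) := closedBall (0 : V n) R with hB
    have hBm : MeasurableSet B := isClosed_closedBall.measurableSet
    have hBc : IsCompact B := isCompact_closedBall _ _
    have hBf : volume B < ⊤ := hBc.measure_lt_top
    let φ : V n → V n := B.indicator u
    have hφm : Measurable φ := hum.indicator hBm
    have hφ1 : ∀ x, ‖φ x‖ ≤ 1 := fun x => (norm_indicator_le_norm_self _ _).trans (hu1 x)
    have hφB : ∀ x, ‖φ x‖ ≤ B.indicator (fun _ => (1 : ℝ)) x := by
      intro x
      by_cases hx : x ∈ B
      · simp [hx, hφ1]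
      · simp [hx, φ]
    have hB1 : Integrable (B.indicator (fun _ => (1 : ℝ))) (volume : Measure (V n)) :=
      (integrable_indicator_iff hBm).2 (integrableOn_const hBf.ne)
    have hφi : Integrable φ := hB1.mono' hφm.aestronglyMeasurable (ae_of_all _ hφB)
    have hφc : HasCompactSupport φ :=
      HasCompactSupport.intro hBc fun x hx => Set.indicator_of_notMem hx _
    let L : V n →L[ℝ] ℝ →L[ℝ] V n := (ContinuousLinearMap.lsmul ℝ ℝ).flip
    let ψ : V n → V n := convolution φ η L volume
    have hψC : ContDiff ℝ 1 ψ :=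
      hηc.contDiff_convolution_right L hφi.locallyIntegrable (by exact_mod_cast hη)
    have hψc : HasCompactSupport ψ := hφc.convolution L hηc
    have hηi : Integrable η := hη.continuous.integrable_of_hasCompactSupport hηc
    have hψ1 : ∀ x, ‖ψ x‖ ≤ 1 := by
      intro x
      have hi : Integrable (fun t => η (x - t)) := hηi.comp_sub_left x
      calc ‖ψ x‖ ≤ ∫ t, η (x - t) := by
            refine norm_integral_le_of_norm_le hi (ae_of_all _ fun t => ?_)
            simp only [L, ContinuousLinearMap.flip_apply, ContinuousLinearMap.lsmul_apply, norm_smul,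
              Real.norm_eq_abs, abs_of_nonneg (hη0 _)]
            exact mul_le_of_le_one_right (hη0 _) (hφ1 t)
        _ = 1 := by rw [integral_sub_left_eq_self, hη1]
    have hψD : ∀ y v, fderiv ℝ ψ y v = ∫ t, (fderiv ℝ η (y - t) v) • φ t := by
      intro y v
      rw [(hηc.hasFDerivAt_convolution_right L hφi.locallyIntegrable hη y).fderiv,
        convolution_precompR_apply _ hφi.locallyIntegrable hDs hDc]
      rfl
    have hint1 : ∀ y v, Integrable (fun t => (fderiv ℝ η (y - t) v) • φ t) := by
      intro y v
      refine hφi.bdd_smul (φ := fun t => fderiv ℝ η (y - t) v) (C * ‖v‖) ?_ (ae_of_all _ fun t => ?_)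
      · exact Continuous.aestronglyMeasurable (by fun_prop)
      · exact (ContinuousLinearMap.le_opNorm _ _).trans (by gcongr; exact hC _)
    have hdiv : ∀ y, vdiv ψ y = ∫ t, fderiv ℝ η (y - t) (φ t) := by
      intro y
      unfold vdiv
      have hcoord : ∀ i, (fderiv ℝ ψ y (EuclideanSpace.single i 1)) i =
          ∫ t, fderiv ℝ η (y - t) (EuclideanSpace.single i 1) * φ t i := by
        intro i
        rw [hψD]
        have := (EuclideanSpace.proj (𝕜 := ℝ) i : V n →L[ℝ] ℝ).integral_comp_comm
          (hint1 y (EuclideanSpace.single i 1))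
        simpa using this.symm
      simp_rw [hcoord]
      rw [← integral_finsetSum]
      · refine integral_congr_ae (ae_of_all _ fun t => ?_)
        have hx : φ t = ∑ i, (φ t i) • (EuclideanSpace.single i (1 : ℝ) : V n) := by
          ext j
          simp [Finset.sum_apply, Pi.single_apply]
        show _ = fderiv ℝ η (y - t) (φ t)
        conv_rhs => rw [hx]
        simp only [map_sum, map_smul, smul_eq_mul]
        exact Finset.sum_congr rfl fun i _ => mul_comm _ _
      · intro i _
        have := (EuclideanSpace.proj (𝕜 := ℝ) i : V n →L[ℝ] ℝ).integrable_comp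
          (hint1 y (EuclideanSpace.single i 1))
        simpa using this
    have hprod : Integrable (Function.uncurry fun y t => f y * fderiv ℝ η (y - t) (φ t))
        (volume.prod volume) := by
      have hb := (hf.norm.mul_prod hB1).mul_const C
      refine hb.mono' ?_ (ae_of_all _ fun p => ?_)
      · refine hf.1.comp_fst.mul ?_
        refine Measurable.aestronglyMeasurable ?_
        have h1 : Measurable fun p : V n × V n => fderiv ℝ η (p.1 - p.2) :=
          Continuous.measurable (by fun_prop)
        have h2 : Measurable fun p : V n × V n => φ p.2 := hφm.comp measurable_snd
        have h3 : Continuous fun q : (V n →L[ℝ] ℝ) × V n => q.1 q.2 := by fun_prop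
        exact h3.measurable.comp (h1.prodMk h2)
      · obtain ⟨y, t⟩ := p
        simp only [Function.uncurry, norm_mul]
        rw [mul_assoc]
        gcongr
        calc _ ≤ ‖fderiv ℝ η (y - t)‖ * ‖φ t‖ := ContinuousLinearMap.le_opNorm _ _
          _ ≤ C * B.indicator (fun _ => (1 : ℝ)) t := by
              gcongr
              · exact (norm_nonneg _).trans (hC 0)
              · exact hC _
              · exact hφB t
          _ = _ := mul_comm _ _
    have hmain : ∫ y, f y * vdiv ψ y = - ∫ x in B, ‖fderiv ℝ g x‖ := by
      calc ∫ y, f y * vdiv ψ y = ∫ y, ∫ t, f y * fderiv ℝ η (y - t) (φ t) := by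
            refine integral_congr_ae (ae_of_all _ fun y => ?_)
            simp only
            rw [hdiv, integral_const_mul]
        _ = ∫ t, ∫ y, f y * fderiv ℝ η (y - t) (φ t) := integral_integral_swap hprod
        _ = ∫ t, - B.indicator (fun x => ‖fderiv ℝ g x‖) t := by
            refine integral_congr_ae (ae_of_all _ fun t => ?_)
            simp only
            have h1 : ∀ y, f y * fderiv ℝ η (y - t) (φ t) = -(f y * fderiv ℝ η (t - y) (φ t)) := by
              intro y
              rw [← neg_sub t y, hDodd]; simp
            simp_rw [h1]
            rw [integral_neg, ← hgD]
            congr 1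
            by_cases ht : t ∈ B
            · simp [φ, ht, huG]
            · simp [φ, ht]
        _ = _ := by rw [integral_neg, integral_indicator hBm]
    have hle : ENNReal.ofReal (∫ y, f y * vdiv (fun x => -ψ x) y) ≤ totalVar f := by
      unfold totalVar
      exact le_iSup (fun φ : {φ : V n → V n // ContDiff ℝ 1 φ ∧ HasCompactSupport φ ∧ ∀ x, ‖φ x‖ ≤ 1} =>
        ENNReal.ofReal (∫ x : V n, f x * vdiv φ.1 x))
        ⟨fun x => -ψ x, hψC.neg, hψc.neg, fun x => by simpa using hψ1 x⟩
    have hvn : ∀ y, vdiv (fun x => -ψ x) y = - vdiv ψ y := by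
      intro y
      unfold vdiv
      rw [← Finset.sum_neg_distrib]
      refine Finset.sum_congr rfl fun i _ => ?_
      rw [fderiv_fun_neg]; simp
    simp_rw [hvn, mul_neg] at hle
    rw [integral_neg, hmain, neg_neg, ofReal_integral_eq_lintegral_ofReal
      (hGc.norm.continuousOn.integrableOn_compact hBc) (ae_of_all _ fun x => norm_nonneg _)] at hle
    simpa only [ofReal_norm] using hle
  have hU : (⋃ R : ℕ, closedBall (0 : V n) R) = Set.univ := iUnion_closedBall_nat 0
  rw [← setLIntegral_univ, ← hU, setLIntegral_iUnion_of_directed]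
  · exact iSup_le key
  · refine Monotone.directed_le ?_
    intro a b hab
    exact closedBall_subset_closedBall (by exact_mod_cast hab)

lemma aux_main (m : ℕ) (f : V (m + 1) → ℝ)
    (hf : Integrable f (volume : Measure (V (m + 1))))
    (ρ : ℝ → ℝ) (hρm : Measurable ρ) (hρ0 : ∀ r : ℝ, 0 < r → 0 ≤ ρ r)
    (hρ1 : ∫ x : V (m + 1), ρ ‖x‖ = 1) :
    ∫⁻ x : V (m + 1), ∫⁻ y : V (m + 1),
        ENNReal.ofReal (|f x - f y| / ‖x - y‖ * ρ ‖x - y‖)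
      ≤ ENNReal.ofReal (Kconst (m + 1) 1) * totalVar f := by
  let b : ℕ → ContDiffBump (0 : V (m + 1)) := fun k =>
    ⟨1 / ((k : ℝ) + 1), 2 / ((k : ℝ) + 1), by positivity, by gcongr; norm_num⟩
  let η : ℕ → V (m + 1) → ℝ := fun k => (b k).normed volume
  let g : ℕ → V (m + 1) → ℝ := fun k x => ∫ t, f t * η k (x - t)
  have hg : ∀ k, ContDiff ℝ 1 (g k) ∧ ∫⁻ x, ‖fderiv ℝ (g k) x‖ₑ ≤ totalVar f := fun k =>
    aux_tv f hf (η k) (b k).contDiff_normed (b k).hasCompactSupport_normed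
      (b k).nonneg_normed (b k).integral_normed (b k).normed_neg
  have hlim : ∀ᵐ x, Tendsto (fun k => g k x) atTop (𝓝 (f x)) := by
    have h1 : Tendsto (fun k => (b k).rOut) atTop (𝓝 0) := by
      have := (tendsto_one_div_add_atTop_nhds_zero_nat (𝕜 := ℝ)).const_mul 2
      simpa [b, div_eq_mul_inv] using this
    have h2 : ∀ᶠ k in atTop, (b k).rOut ≤ 2 * (b k).rIn :=
      Eventually.of_forall fun k => le_of_eq (by simp [b, div_eq_mul_inv])
    filter_upwards [ContDiffBump.ae_convolution_tendsto_right_of_locallyIntegrable h1 h2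
      hf.locallyIntegrable] with x hx
    convert hx using 2 with k
    rw [convolution_lsmul_swap]
    refine integral_congr_ae (ae_of_all _ fun t => ?_)
    simp [η, mul_comm]
  have hbound : ∀ k, ∫⁻ x : V (m + 1), ∫⁻ y : V (m + 1),
        ENNReal.ofReal (|g k x - g k y| / ‖x - y‖ * ρ ‖x - y‖)
      ≤ ENNReal.ofReal (Kconst (m + 1) 1) * totalVar f := fun k =>
    (aux_smooth m ρ hρm hρ0 hρ1 (g k) (hg k).1).trans (mul_le_mul_right (hg k).2 _)
  have hmeas : ∀ k, Measurable fun p : V (m + 1) × V (m + 1) =>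
      ENNReal.ofReal (|g k p.1 - g k p.2| / ‖p.1 - p.2‖ * ρ ‖p.1 - p.2‖) := by
    intro k
    have hc : Continuous (g k) := (hg k).1.continuous
    have hn : Measurable fun p : V (m + 1) × V (m + 1) => ‖p.1 - p.2‖ :=
      Continuous.measurable (by fun_prop)
    have hd : Measurable fun p : V (m + 1) × V (m + 1) => |g k p.1 - g k p.2| :=
      Continuous.measurable (by fun_prop)
    exact ENNReal.measurable_ofReal.comp ((hd.div hn).mul (hρm.comp hn))
  calc ∫⁻ x : V (m + 1), ∫⁻ y : V (m + 1),
        ENNReal.ofReal (|f x - f y| / ‖x - y‖ * ρ ‖x - y‖)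
      ≤ ∫⁻ x : V (m + 1), liminf (fun k => ∫⁻ y : V (m + 1),
        ENNReal.ofReal (|g k x - g k y| / ‖x - y‖ * ρ ‖x - y‖)) atTop := by
        refine lintegral_mono_ae ?_
        filter_upwards [hlim] with x hx
        calc _ = ∫⁻ y : V (m + 1), liminf (fun k =>
            ENNReal.ofReal (|g k x - g k y| / ‖x - y‖ * ρ ‖x - y‖)) atTop := by
              refine lintegral_congr_ae ?_
              filter_upwards [hlim] with y hy
              refine (Tendsto.liminf_eq ?_).symm
              refine (ENNReal.continuous_ofReal.tendsto _).comp ?_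
              exact (((hx.sub hy).abs).div_const _).mul_const _
          _ ≤ _ := lintegral_liminf_le' fun k =>
              ((hmeas k).comp measurable_prodMk_left).aemeasurable
    _ ≤ liminf (fun k => ∫⁻ x : V (m + 1), ∫⁻ y : V (m + 1),
        ENNReal.ofReal (|g k x - g k y| / ‖x - y‖ * ρ ‖x - y‖)) atTop :=
        lintegral_liminf_le' fun k => ((hmeas k).lintegral_prod_right').aemeasurable
    _ ≤ liminf (fun _ : ℕ => ENNReal.ofReal (Kconst (m + 1) 1) * totalVar f) atTop :=
        liminf_le_liminf (Eventually.of_forall hbound)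
    _ = _ := by simp


/-- For `f ∈ BV(ℝⁿ)` and a nonnegative measurable `ρ` with
`∫_{ℝⁿ} ρ(|x|) dx = 1`, one has
`∬ |f(x)−f(y)|/|x−y| ρ(|x−y|) dx dy ≤ 𝐄_{1,n} ∫ |Df|`. -/
theorem statement8 (n : ℕ) (hn : 1 ≤ n) (f : V n → ℝ)
    (hf : Integrable f (volume : Measure (V n))) (hbv : totalVar f < ⊤)
    (ρ : ℝ → ℝ) (hρm : Measurable ρ) (hρ0 : ∀ r : ℝ, 0 < r → 0 ≤ ρ r)
    (hρ1 : ∫ x : V n, ρ ‖x‖ = 1) :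
    ∫⁻ x : V n, ∫⁻ y : V n,
        ENNReal.ofReal (|f x - f y| / ‖x - y‖ * ρ ‖x - y‖)
      ≤ ENNReal.ofReal (Kconst n 1) * totalVar f := by
  obtain ⟨m, rfl⟩ : ∃ m, n = m + 1 := ⟨n - 1, by omega⟩
  exact aux_main m f hf ρ hρm hρ0 hρ1
end
end

section
/- Let n ≥ 2 and let G satisfy (H1)–(H2). Then for every set of finite perimeter E ⊂ ℝⁿ, Per_G(E) ≤ P(E), i.e. ∬_{E × Eᶜ} G(x−y) dx dy ≤ P(E). -/
open MeasureTheory Metric Filter Asymptotics ENNReal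
open scoped ENNReal NNReal Topology

noncomputable section

/-- Hypotheses (H1)–(H2): `G` is a nonnegative measurable radial kernel on `ℝⁿ`,
integrable, with first moment `∫ |x| G(x) dx = 2/𝐄_{1,n}`. -/
structure H12 {n : ℕ} (G : V n → ℝ) : Prop where
  measurable : Measurable G
  nonneg : ∀ x, 0 ≤ G x
  radial : ∃ g : ℝ → ℝ, (∀ r, 0 < r → 0 ≤ g r) ∧ ∀ᵐ x : V n ∂volume, G x = g ‖x‖
  integrable : Integrable G (volume : Measure (V n))
  firstMoment : ∫ x : V n, ‖x‖ * G x = 2 / Kconst n 1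


/-- The nonlocal `G`-perimeter, as an extended real. -/
def PerGe {n : ℕ} (G : V n → ℝ) (E : Set (V n)) : ℝ≥0∞ :=
  ∫⁻ x in E, ∫⁻ y in Eᶜ, ENNReal.ofReal (G (x - y))



lemma finrank_orth {n : ℕ} (hn : 1 ≤ n) (v : V n) (hv : ‖v‖ = 1) :
    Module.finrank ℝ (ℝ ∙ v)ᗮ = n - 1 := by
  have : Fact (Module.finrank ℝ (V n) = (n - 1) + 1) := ⟨by simp; omega⟩
  exact Submodule.finrank_orthogonal_span_singleton (by intro h; simp [h] at hv)

lemma half_sphere_lt_top {n : ℕ} (hn : 1 ≤ n) (v : V n) (hv : ‖v‖ = 1) :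
    (μH[(n : ℝ) - 1] : Measure (V n)) {x | ‖x‖ = 1 ∧ inner ℝ v x ≤ 0} < ⊤ := by
  have hfr := finrank_orth hn v hv
  have hd : ((n : ℝ) - 1) = (Module.finrank ℝ (ℝ ∙ v)ᗮ : ℝ) := by
    rw [hfr]; push_cast [hn]; rfl
  obtain ⟨K, hK⟩ := ContDiffOn.exists_lipschitzOnWith (n := 1) (f := fun w : (ℝ ∙ v)ᗮ => stereoInvFunAux v (w : V n))
    (s := closedBall (0 : (ℝ ∙ v)ᗮ) 2)
    ((contDiff_stereoInvFunAux.comp (ℝ ∙ v)ᗮ.subtypeL.contDiff).contDiffOn) (by simp)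
    (convex_closedBall _ _) (isCompact_closedBall _ _)
  have hsub : {x : V n | ‖x‖ = 1 ∧ inner ℝ v x ≤ 0} ⊆
      (fun w : (ℝ ∙ v)ᗮ => stereoInvFunAux v (w : V n)) '' closedBall (0 : (ℝ ∙ v)ᗮ) 2 := by
    rintro x ⟨hx, hx2⟩
    refine ⟨stereoToFun v x, ?_, ?_⟩
    · rw [mem_closedBall_zero_iff, stereoToFun_apply, norm_smul]
      have h1 : ‖(ℝ ∙ v)ᗮ.orthogonalProjectionOnto x‖ ≤ 1 := by
        have := (ℝ ∙ v)ᗮ.norm_orthogonalProjectionOnto_apply_le x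
        linarith
      have h2 : ‖2 / ((1 : ℝ) - innerSL ℝ v x)‖ ≤ 2 := by
        rw [innerSL_apply_apply, Real.norm_eq_abs, abs_of_nonneg (by apply div_nonneg <;> linarith)]
        rw [div_le_iff₀ (by linarith)]; linarith
      nlinarith [norm_nonneg ((ℝ ∙ v)ᗮ.orthogonalProjectionOnto x)]
    · have := stereo_left_inv hv (x := ⟨x, by simpa using hx⟩) (by
        rintro rfl
        simp only at hx2
        rw [real_inner_self_eq_norm_sq, hv] at hx2; norm_num at hx2)
      exact congrArg Subtype.val this
  refine (measure_mono hsub).trans_lt ?_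
  refine (hK.hausdorffMeasure_image_le (by rw [hd]; positivity)).trans_lt ?_
  rw [hd]
  refine ENNReal.mul_lt_top ?_ (isCompact_closedBall _ _).measure_lt_top
  exact ENNReal.rpow_lt_top_of_nonneg (by positivity) (by simp)

lemma sphere_lt_top {n : ℕ} (hn : 1 ≤ n) :
    (μH[(n : ℝ) - 1] : Measure (V n)) (sphere 0 1) < ⊤ := by
  set v : V n := EuclideanSpace.single ⟨0, hn⟩ 1
  have hv : ‖v‖ = 1 := by simp [v]
  have h : sphere (0 : V n) 1 ⊆ {x | ‖x‖ = 1 ∧ inner ℝ v x ≤ 0} ∪ {x | ‖x‖ = 1 ∧ inner ℝ (-v) x ≤ 0} := by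
    intro x hx
    have hx : ‖x‖ = 1 := by simpa using hx
    rcases le_total (inner ℝ v x) 0 with h | h
    · exact Or.inl ⟨hx, h⟩
    · exact Or.inr ⟨hx, by rw [inner_neg_left]; linarith⟩
  exact ((measure_mono h).trans (measure_union_le _ _)).trans_lt
    (ENNReal.add_lt_top.2 ⟨half_sphere_lt_top hn v hv, half_sphere_lt_top hn (-v) (by simpa using hv)⟩)

lemma sphere_pos {n : ℕ} (hn : 1 ≤ n) :
    0 < (μH[(n : ℝ) - 1] : Measure (V n)) (sphere 0 1) := by
  set v : V n := EuclideanSpace.single ⟨0, hn⟩ 1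
  have hv : ‖v‖ = 1 := by simp [v]
  have hfr := finrank_orth hn v hv
  have hd : ((n : ℝ) - 1) = (Module.finrank ℝ (ℝ ∙ v)ᗮ : ℝ) := by
    rw [hfr]; push_cast [hn]; rfl
  have h1 := (ℝ ∙ v)ᗮ.lipschitzWith_orthogonalProjectionOnto.hausdorffMeasure_image_le
    (d := (n : ℝ) - 1) (by rw [hd]; positivity) (sphere 0 1)
  rw [ENNReal.coe_one, ENNReal.one_rpow, one_mul] at h1
  refine lt_of_lt_of_le ?_ h1
  have hsub : ball (0 : (ℝ ∙ v)ᗮ) 1 ⊆ (ℝ ∙ v)ᗮ.orthogonalProjectionOnto '' sphere 0 1 := by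
    intro w hw
    rw [mem_ball_zero_iff] at hw
    have hvw : inner ℝ (w : V n) v = 0 := (Submodule.mem_orthogonal_singleton_iff_inner_left).1 w.2
    refine ⟨(w : V n) + Real.sqrt (1 - ‖w‖ ^ 2) • v, ?_, ?_⟩
    · rw [mem_sphere_zero_iff_norm, ← sq_eq_sq₀ (norm_nonneg _) zero_le_one, norm_add_sq_real,
        inner_smul_right, hvw, norm_smul, hv, Real.norm_eq_abs, mul_one, sq_abs,
        Real.sq_sqrt (by nlinarith [norm_nonneg w])]
      simp
    · rw [map_add, map_smul]
      simp [Submodule.orthogonalProjectionOnto_orthogonal_apply_eq_zero]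
  refine lt_of_lt_of_le ?_ (measure_mono hsub)
  rw [hd]
  exact measure_ball_pos _ _ one_pos

lemma exists_rot {n : ℕ} (v w : V n) (h : ‖v‖ = ‖w‖) : ∃ R : V n ≃ₗᵢ[ℝ] V n, R v = w :=
  ⟨_, Submodule.reflection_sub h⟩

lemma rot_lintegral {n : ℕ} (μ : Measure (V n))
    (hμ : ∀ R : V n ≃ₗᵢ[ℝ] V n, MeasurePreserving R μ μ) (F : ℝ → ℝ≥0∞)
    (e z : V n) (he : ‖e‖ = 1) :
    ∫⁻ x, F (inner ℝ z x) ∂μ = ∫⁻ x, F (‖z‖ * inner ℝ e x) ∂μ := by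
  obtain ⟨R, hR⟩ := exists_rot (‖z‖ • e) z (by simp [norm_smul, he])
  have hm := hμ R
  rw [← hm.lintegral_comp_emb R.toHomeomorph.measurableEmbedding]
  refine lintegral_congr fun x => ?_
  have h : inner ℝ z (R x) = ‖z‖ * inner ℝ e x := by
    conv_lhs => rw [← hR]
    rw [R.inner_map_map, real_inner_smul_left]
  rw [h]

lemma rot_abs {n : ℕ} (μ : Measure (V n))
    (hμ : ∀ R : V n ≃ₗᵢ[ℝ] V n, MeasurePreserving R μ μ)
    (e z : V n) (he : ‖e‖ = 1) :
    ∫⁻ x, ENNReal.ofReal |inner ℝ z x| ∂μ = ENNReal.ofReal ‖z‖ * ∫⁻ x, ENNReal.ofReal |inner ℝ e x| ∂μ := by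
  rw [rot_lintegral μ hμ (fun t => ENNReal.ofReal |t|) e z he,
    ← lintegral_const_mul _ (by fun_prop)]
  refine lintegral_congr fun x => ?_
  rw [abs_mul, ENNReal.ofReal_mul (abs_nonneg _), abs_norm]

lemma rot_pos {n : ℕ} (μ : Measure (V n))
    (hμ : ∀ R : V n ≃ₗᵢ[ℝ] V n, MeasurePreserving R μ μ)
    (e z : V n) (he : ‖e‖ = 1) :
    ∫⁻ x, ENNReal.ofReal (inner ℝ z x) ∂μ = ENNReal.ofReal ‖z‖ * ∫⁻ x, ENNReal.ofReal (inner ℝ e x) ∂μ := by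
  rw [rot_lintegral μ hμ (fun t => ENNReal.ofReal t) e z he,
    ← lintegral_const_mul _ (by fun_prop)]
  refine lintegral_congr fun x => ?_
  rw [ENNReal.ofReal_mul (norm_nonneg _)]

lemma abs_two_pos {n : ℕ} (μ : Measure (V n))
    (hμ : ∀ R : V n ≃ₗᵢ[ℝ] V n, MeasurePreserving R μ μ)
    (e : V n) (he : ‖e‖ = 1) :
    ∫⁻ x, ENNReal.ofReal |inner ℝ e x| ∂μ = 2 * ∫⁻ x, ENNReal.ofReal (inner ℝ e x) ∂μ := by
  have h1 := rot_pos μ hμ e (-e) he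
  rw [norm_neg, he, ENNReal.ofReal_one, one_mul] at h1
  rw [two_mul]
  nth_rewrite 2 [← h1]
  rw [← lintegral_add_left (by fun_prop)]
  refine lintegral_congr fun x => ?_
  rw [inner_neg_left]
  rcases le_total 0 (inner ℝ e x) with h | h
  · rw [abs_of_nonneg h, ENNReal.ofReal_of_nonpos (p := -_) (by linarith), add_zero]
  · rw [abs_of_nonpos h, ENNReal.ofReal_of_nonpos h, zero_add]

lemma fubini_const {n : ℕ} (μ σ : Measure (V n)) [SFinite μ] [SFinite σ]
    (hμ : ∀ R : V n ≃ₗᵢ[ℝ] V n, MeasurePreserving R μ μ)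
    (hσ : ∀ R : V n ≃ₗᵢ[ℝ] V n, MeasurePreserving R σ σ) (e : V n) (he : ‖e‖ = 1) :
    (∫⁻ x, ENNReal.ofReal |inner ℝ e x| ∂μ) * ∫⁻ x, ENNReal.ofReal ‖x‖ ∂σ =
    (∫⁻ x, ENNReal.ofReal |inner ℝ e x| ∂σ) * ∫⁻ x, ENNReal.ofReal ‖x‖ ∂μ := by
  have h := lintegral_lintegral_swap (μ := μ) (ν := σ) (f := fun z x => ENNReal.ofReal |inner ℝ z x|)
    (by unfold Function.uncurry; fun_prop)
  rw [lintegral_congr fun z => rot_abs σ hσ e z he] at h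
  have h2 : ∀ y, ∫⁻ x, ENNReal.ofReal |inner ℝ x y| ∂μ =
      ENNReal.ofReal ‖y‖ * ∫⁻ x, ENNReal.ofReal |inner ℝ e x| ∂μ := by
    intro y
    rw [← rot_abs μ hμ e y he]
    exact lintegral_congr fun x => by rw [real_inner_comm]
  rw [lintegral_congr h2] at h
  rw [lintegral_mul_const _ (by fun_prop), lintegral_mul_const _ (by fun_prop)] at h
  rw [mul_comm, ← h, mul_comm]

lemma const_eq_one {n : ℕ} (hn : 1 ≤ n) (G : V n → ℝ) (hG : H12 G) (v : V n) :
    ∫⁻ z, ENNReal.ofReal (G z) * ENNReal.ofReal (inner ℝ v z) = ENNReal.ofReal ‖v‖ := by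
  set i0 : Fin n := ⟨0, hn⟩
  set e : V n := EuclideanSpace.single i0 1 with he_def
  have he : ‖e‖ = 1 := by simp [e]
  set σ : Measure (V n) := (μH[(n : ℝ) - 1] : Measure (V n)).restrict (sphere 0 1) with hσ_def
  set s := (μH[(n : ℝ) - 1] : Measure (V n)) (sphere 0 1) with hs_def
  have hs0 : s ≠ 0 := (sphere_pos hn).ne'
  have hst : s ≠ ⊤ := (sphere_lt_top hn).ne
  have hσu : σ Set.univ = s := by simp [hσ_def, hs_def]
  have : IsFiniteMeasure σ := ⟨by rw [hσu]; exact hst.lt_top⟩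
  set μ : Measure (V n) := (volume : Measure (V n)).withDensity (fun z => ENNReal.ofReal (G z)) with hμ_def
  have hGm : Measurable (fun z => ENNReal.ofReal (G z)) := hG.measurable.ennreal_ofReal
  have hσ : ∀ R : V n ≃ₗᵢ[ℝ] V n, MeasurePreserving R σ σ := by
    intro R
    have := (R.toIsometryEquiv.measurePreserving_hausdorffMeasure ((n : ℝ) - 1)).restrict_preimage_emb
      R.toHomeomorph.measurableEmbedding (sphere 0 1)
    have h2 : (R.toIsometryEquiv) ⁻¹' (sphere (0 : V n) 1) = sphere 0 1 := by
      ext x; simp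
    rw [h2] at this
    exact this
  have hμ : ∀ R : V n ≃ₗᵢ[ℝ] V n, MeasurePreserving R μ μ := by
    intro R
    refine ⟨R.continuous.measurable, ?_⟩
    ext A hA
    rw [Measure.map_apply R.continuous.measurable hA, withDensity_apply _ hA,
      withDensity_apply _ (R.continuous.measurable hA)]
    have hp := R.measurePreserving
    rw [← hp.setLIntegral_comp_preimage_emb R.toHomeomorph.measurableEmbedding _ A]
    obtain ⟨g, hg0, hg⟩ := hG.radial
    refine lintegral_congr_ae (ae_restrict_of_ae ?_)
    filter_upwards [hg, hp.quasiMeasurePreserving.ae hg] with x hx hx2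
    rw [hx, hx2, R.norm_map]
  have hfub := fubini_const μ σ hμ hσ e he
  have hσn : ∫⁻ x, ENNReal.ofReal ‖x‖ ∂σ = s := by
    rw [hσ_def, setLIntegral_congr_fun (g := fun _ => 1) isClosed_sphere.measurableSet]
    · simp [hs_def]
    · intro x hx
      have : ‖x‖ = 1 := by simpa using hx
      simp [this]
  set a := ∫⁻ x, ENNReal.ofReal |inner ℝ e x| ∂σ with ha_def
  have ha_le : a ≤ s := by
    rw [← hσn]
    refine lintegral_mono fun x => ENNReal.ofReal_le_ofReal ?_
    have := abs_real_inner_le_norm e x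
    rwa [he, one_mul] at this
  have hat : a ≠ ⊤ := ne_top_of_le_ne_top hst ha_le
  have ha0 : a ≠ 0 := by
    intro h0
    have h1 : ∀ i : Fin n, ∀ᵐ x ∂σ, x i = 0 := by
      intro i
      have h2 := rot_abs σ hσ e (EuclideanSpace.single i 1) he
      rw [← ha_def, h0, mul_zero, lintegral_eq_zero_iff (by fun_prop)] at h2
      filter_upwards [h2] with x hx
      simpa [EuclideanSpace.inner_single_left] using hx
    have h3 : ∀ᵐ x ∂σ, ENNReal.ofReal ‖x‖ = 0 := by
      filter_upwards [ae_all_iff.2 h1] with x hx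
      have : x = 0 := by ext i; simpa using hx i
      simp [this]
    rw [lintegral_congr_ae h3] at hσn
    simp at hσn
    exact hs0 hσn.symm
  have hK : Kconst n 1 = s.toReal⁻¹ * a.toReal := by
    have hn0 : n ≠ 0 := by omega
    rw [Kconst, dif_neg hn0, setAverage_eq, smul_eq_mul, measureReal_def]
    congr 1
    simp only [Real.rpow_one]
    rw [integral_eq_lintegral_of_nonneg_ae (Eventually.of_forall fun x => by positivity) (by fun_prop)]
    congr 1
    refine lintegral_congr fun x => ?_
    simp [he_def, EuclideanSpace.inner_single_left, i0]
  have hKpos : 0 < Kconst n 1 := by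
    rw [hK]
    exact mul_pos (inv_pos.2 (ENNReal.toReal_pos hs0 hst)) (ENNReal.toReal_pos ha0 hat)
  have hfm : ∫⁻ x, ENNReal.ofReal ‖x‖ ∂μ = ENNReal.ofReal (2 / Kconst n 1) := by
    rw [← hG.firstMoment, ofReal_integral_eq_lintegral_ofReal]
    · rw [hμ_def, lintegral_withDensity_eq_lintegral_mul _ hGm (by fun_prop)]
      refine lintegral_congr fun x => ?_
      rw [ENNReal.ofReal_mul (norm_nonneg _), Pi.mul_apply, mul_comm]
    · by_contra hni
      have := hG.firstMoment
      rw [integral_undef hni] at this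
      have h2 : 0 < 2 / Kconst n 1 := by positivity
      linarith
    · exact Eventually.of_forall fun x => mul_nonneg (norm_nonneg _) (hG.nonneg x)
  set b := ∫⁻ x, ENNReal.ofReal (inner ℝ e x) ∂μ with hb_def
  have hb : b = 1 := by
    rw [abs_two_pos μ hμ e he, ← hb_def, hσn, hfm, hK] at hfub
    have h1 : a * ENNReal.ofReal (2 / (s.toReal⁻¹ * a.toReal)) = 2 * s := by
      have hsp := ENNReal.toReal_pos hs0 hst
      have hap := ENNReal.toReal_pos ha0 hat
      rw [← ENNReal.ofReal_toReal hat, ENNReal.toReal_ofReal hap.le, ← ENNReal.ofReal_mul hap.le]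
      have : a.toReal * (2 / (s.toReal⁻¹ * a.toReal)) = 2 * s.toReal := by field_simp
      rw [this, ENNReal.ofReal_mul zero_le_two, ENNReal.ofReal_toReal hst]
      simp
    rw [h1, mul_assoc] at hfub
    have h2 := (ENNReal.mul_right_inj (by simp) (by simp)).1 hfub
    calc b = b * s / s := (ENNReal.mul_div_cancel_right hs0 hst).symm
      _ = 1 := by rw [h2, ENNReal.div_self hs0 hst]
  have hfin := rot_pos μ hμ e v he
  rw [← hb_def, hb, mul_one] at hfin
  rw [← hfin, hμ_def, lintegral_withDensity_eq_lintegral_mul _ hGm (by fun_prop)]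
  rfl

lemma fatou_bound {α : Type*} [MeasurableSpace α] {μ : Measure α} (f : ℕ → α → ℝ≥0∞)
    (F : α → ℝ≥0∞) (C : ℝ≥0∞) (hf : ∀ k, Measurable (f k))
    (hlim : ∀ᵐ x ∂μ, Tendsto (fun k => f k x) atTop (𝓝 (F x)))
    (hC : ∀ k, ∫⁻ x, f k x ∂μ ≤ C) : ∫⁻ x, F x ∂μ ≤ C := by
  calc ∫⁻ x, F x ∂μ = ∫⁻ x, liminf (fun k => f k x) atTop ∂μ :=
        lintegral_congr_ae (hlim.mono fun x hx => hx.liminf_eq.symm)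
    _ ≤ liminf (fun k => ∫⁻ x, f k x ∂μ) atTop := lintegral_liminf_le hf
    _ ≤ liminf (fun _ : ℕ => C) atTop := liminf_le_liminf (Eventually.of_forall hC)
    _ = C := by simp

open scoped Convolution
open ContinuousLinearMap (lsmul)

/-- mollification of the indicator of `E` -/
def mol {n : ℕ} (E : Set (V n)) (ρ : V n → ℝ) : V n → ℝ :=
  (E.indicator (fun _ => (1 : ℝ))) ⋆[lsmul ℝ ℝ, volume] ρ

lemma locInt_ind {n : ℕ} {E : Set (V n)} (hE : MeasurableSet E) :
    LocallyIntegrable (E.indicator (fun _ => (1 : ℝ))) (volume : Measure (V n)) :=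
  (locallyIntegrable_const 1).indicator hE

lemma mol_contDiff {n : ℕ} {E : Set (V n)} (hE : MeasurableSet E) {ρ : V n → ℝ}
    (hρ : ContDiff ℝ 1 ρ) (hc : HasCompactSupport ρ) : ContDiff ℝ 1 (mol E ρ) :=
  hc.contDiff_convolution_right (n := 1) _ (locInt_ind hE) hρ

lemma mol_fderiv {n : ℕ} {E : Set (V n)} (hE : MeasurableSet E) {ρ : V n → ℝ}
    (hρ : ContDiff ℝ 1 ρ) (hc : HasCompactSupport ρ) (x h : V n) :
    fderiv ℝ (mol E ρ) x h = ∫ t in E, fderiv ℝ ρ (x - t) h := by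
  have h1 := (hc.hasFDerivAt_convolution_right (lsmul ℝ ℝ) (locInt_ind hE) hρ x).fderiv
  rw [mol, h1, convolution_precompR_apply _ (locInt_ind hE) (hc.fderiv ℝ) (hρ.continuous_fderiv (by simp)),
    convolution_def, ← integral_indicator hE]
  refine integral_congr_ae (Eventually.of_forall fun t => ?_)
  by_cases ht : t ∈ E <;> simp [ht]

lemma conv_vdiv {n : ℕ} {ρ : V n → ℝ} {φ : V n → V n}
    (hρ : ContDiff ℝ 1 ρ) (hc : HasCompactSupport ρ) (hφ : Continuous φ) (y : V n) :
    vdiv (φ ⋆[(lsmul ℝ ℝ).flip, volume] ρ) y = ∫ x, fderiv ℝ ρ (y - x) (φ x) := by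
  have hli : LocallyIntegrable φ (volume : Measure (V n)) := hφ.locallyIntegrable
  have h1 := (hc.hasFDerivAt_convolution_right ((lsmul ℝ ℝ).flip : V n →L[ℝ] ℝ →L[ℝ] V n) hli hρ y).fderiv
  have hdc := hρ.continuous_fderiv (by simp)
  have hIntg : ∀ h : V n, Integrable (fun x => fderiv ℝ ρ (y - x) h • φ x) := by
    intro h
    refine Continuous.integrable_of_hasCompactSupport ((hdc.comp (by fun_prop)).clm_apply continuous_const |>.smul hφ) ?_
    have h2 : HasCompactSupport (fun x => fderiv ℝ ρ (y - x)) :=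
      (hc.fderiv ℝ).comp_homeomorph (Homeomorph.subLeft y)
    exact h2.mono' (fun x hx => subset_tsupport _ (by
      intro h0
      apply hx
      simp only at h0
      simp [h0]))
  have h2 : ∀ i : Fin n, fderiv ℝ (φ ⋆[(lsmul ℝ ℝ).flip, volume] ρ) y (EuclideanSpace.single i 1) i =
      ∫ x, fderiv ℝ ρ (y - x) (EuclideanSpace.single i 1) * φ x i := by
    intro i
    rw [h1, convolution_precompR_apply _ hli (hc.fderiv ℝ) hdc, convolution_def]
    have := (EuclideanSpace.proj (𝕜 := ℝ) i : V n →L[ℝ] ℝ).integral_comp_comm (hIntg (EuclideanSpace.single i 1))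
    simpa using this.symm
  unfold vdiv
  simp_rw [h2]
  rw [← integral_finsetSum]
  · refine integral_congr_ae (Eventually.of_forall fun x => ?_)
    have h3 : φ x = ∑ i, φ x i • EuclideanSpace.single i (1 : ℝ) := by
      simpa using ((EuclideanSpace.basisFun (Fin n) ℝ).sum_repr (φ x)).symm
    simp only
    conv_rhs => rw [h3]
    rw [map_sum]
    refine Finset.sum_congr rfl fun i _ => ?_
    rw [map_smul, smul_eq_mul, mul_comm]
  · intro i _
    have := (EuclideanSpace.proj (𝕜 := ℝ) i : V n →L[ℝ] ℝ).integrable_comp (hIntg (EuclideanSpace.single i 1))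
    simpa using this

lemma fubini_int {n : ℕ} (E : Set (V n)) {ρ : V n → ℝ}
    (hρ : ContDiff ℝ 1 ρ) (hc : HasCompactSupport ρ)
    {φ : V n → V n} (hφ : Continuous φ) (hφc : HasCompactSupport φ) :
    Integrable (fun p : V n × V n => fderiv ℝ ρ (p.1 - p.2) (- φ p.2))
        ((volume.restrict E).prod volume) := by
  have hdc := hρ.continuous_fderiv (by simp)
  have h1 : Integrable (fun p : V n × V n => fderiv ℝ ρ (p.1 - p.2) (- φ p.2))
      ((volume : Measure (V n)).prod (volume : Measure (V n))) := by
    refine Continuous.integrable_of_hasCompactSupport ?_ ?_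
    · exact (hdc.comp (by fun_prop)).clm_apply (by fun_prop)
    · refine HasCompactSupport.intro
        (K := (fun p : V n × V n => (p.1 + p.2, p.2)) '' (tsupport ρ ×ˢ tsupport φ)) ?_ ?_
      · exact (hc.isCompact.prod hφc.isCompact).image (by fun_prop)
      · rintro ⟨y, x⟩ hp
        by_cases hx : x ∈ tsupport φ
        · have hy : y - x ∉ tsupport ρ := fun hy => hp ⟨(y - x, x), ⟨hy, hx⟩, by simp⟩
          have : fderiv ℝ ρ (y - x) = 0 := by
            by_contra h
            exact hy (support_fderiv_subset ℝ h)
          simp [this]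
        · simp [image_eq_zero_of_notMem_tsupport hx]
  have h2 := h1.restrict (s := E ×ˢ Set.univ)
  rwa [← Measure.prod_restrict, Measure.restrict_univ] at h2

lemma mol_test {n : ℕ} {E : Set (V n)} (hE : MeasurableSet E) {ρ : V n → ℝ}
    (hρ : ContDiff ℝ 1 ρ) (hc : HasCompactSupport ρ) (heven : ∀ x, ρ (-x) = ρ x)
    (hρ0 : ∀ x, 0 ≤ ρ x) (hρ1 : ∫ x, ρ x = 1)
    {φ : V n → V n} (hφ : Continuous φ) (hφc : HasCompactSupport φ) (hφ1 : ∀ x, ‖φ x‖ ≤ 1) :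
    ENNReal.ofReal (∫ x, fderiv ℝ (mol E ρ) x (φ x)) ≤ perimeter E := by
  have hdc := hρ.continuous_fderiv (by simp)
  obtain ⟨ψ, hψ⟩ : ∃ ψ : V n → V n, ψ = ((fun x => - φ x) ⋆[(lsmul ℝ ℝ).flip, volume] ρ) := ⟨_, rfl⟩
  have hli : LocallyIntegrable (fun x => - φ x) (volume : Measure (V n)) := hφ.neg.locallyIntegrable
  have hnc : HasCompactSupport (fun x => - φ x) := hφc.comp_left (g := fun x => - x) (by simp)
  have hψ1 : ContDiff ℝ 1 ψ := by rw [hψ]; exact hc.contDiff_convolution_right (n := 1) _ hli hρ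
  have hψc : HasCompactSupport ψ := by rw [hψ]; exact hnc.convolution _ hc
  have hρi : Integrable ρ := hρ.continuous.integrable_of_hasCompactSupport hc
  have hψb : ∀ x, ‖ψ x‖ ≤ 1 := by
    intro x
    rw [hψ, convolution_def]
    calc _ ≤ ∫ t, ρ (x - t) := by
          refine norm_integral_le_of_norm_le (hρi.comp_sub_left x) (Eventually.of_forall fun t => ?_)
          simp only [ContinuousLinearMap.flip_apply, ContinuousLinearMap.lsmul_apply, norm_smul,
            norm_neg, Real.norm_eq_abs, abs_of_nonneg (hρ0 _)]
          exact mul_le_of_le_one_right (hρ0 _) (hφ1 t)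
      _ = 1 := by rw [integral_sub_left_eq_self ρ volume x, hρ1]
  have hodd : ∀ x, fderiv ℝ ρ (-x) = - fderiv ℝ ρ x := by
    intro x
    have h1 : HasFDerivAt ρ (fderiv ℝ ρ (-x)) (-x) := (hρ.differentiable (by simp) _).hasFDerivAt
    have h2 := h1.comp x (hasFDerivAt_id (𝕜 := ℝ) x).neg
    have h4 : HasFDerivAt ρ ((fderiv ℝ ρ (-x)).comp (-ContinuousLinearMap.id ℝ (V n))) x :=
      h2.congr_of_eventuallyEq (Eventually.of_forall fun y => (heven y).symm)
    rw [h4.fderiv]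
    ext y
    simp
  have key : ∫ y in E, vdiv ψ y = ∫ x, fderiv ℝ (mol E ρ) x (φ x) := by
    have hIntg := fubini_int E hρ hc hφ hφc
    calc ∫ y in E, vdiv ψ y = ∫ y in E, ∫ x, fderiv ℝ ρ (y - x) (- φ x) := by
          refine integral_congr_ae (Eventually.of_forall fun y => ?_)
          simp only [hψ]
          exact conv_vdiv hρ hc hφ.neg y
      _ = ∫ x, ∫ y in E, fderiv ℝ ρ (y - x) (- φ x) := integral_integral_swap hIntg
      _ = ∫ x, fderiv ℝ (mol E ρ) x (φ x) := by
          refine integral_congr_ae (Eventually.of_forall fun x => ?_)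
          simp only
          rw [mol_fderiv hE hρ hc]
          refine integral_congr_ae (Eventually.of_forall fun y => ?_)
          simp only
          rw [← neg_sub x y, hodd]; simp
  rw [← key]
  exact le_iSup (fun φ : {φ : V n → V n // ContDiff ℝ 1 φ ∧ HasCompactSupport φ ∧ ∀ x, ‖φ x‖ ≤ 1} =>
    ENNReal.ofReal (∫ x in E, vdiv φ.1 x)) ⟨ψ, hψ1, hψc, hψb⟩

lemma mol_tv {n : ℕ} {E : Set (V n)} (hE : MeasurableSet E) {ρ : V n → ℝ}
    (hρ : ContDiff ℝ 1 ρ) (hc : HasCompactSupport ρ) (heven : ∀ x, ρ (-x) = ρ x)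
    (hρ0 : ∀ x, 0 ≤ ρ x) (hρ1 : ∫ x, ρ x = 1) :
    ∫⁻ x, ENNReal.ofReal ‖gradient (mol E ρ) x‖ ≤ perimeter E := by
  set g := gradient (mol E ρ) with hg
  have hgc : Continuous g :=
    (InnerProductSpace.toDual ℝ (V n)).symm.continuous.comp
      ((mol_contDiff hE hρ hc).continuous_fderiv (by simp))
  have hgi : ∀ x h, fderiv ℝ (mol E ρ) x h = inner ℝ (g x) h := by
    intro x h
    rw [hg, gradient, InnerProductSpace.toDual_symm_apply]
  let η : ℕ → ContDiffBump (0 : V n) := fun k => ⟨k + 1, k + 2, by positivity, by linarith⟩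
  set δ : ℕ → ℝ := fun k => 1 / ((k : ℝ) + 1) with hδ
  have hδ0 : ∀ k, 0 < δ k := fun k => by simp only [hδ]; positivity
  have hpos : ∀ k x, 0 < δ k + ‖g x‖ := fun k x => by have := hδ0 k; positivity
  set φ : ℕ → V n → V n := fun k x => (η k x * (δ k + ‖g x‖)⁻¹) • g x with hφ
  have hcoef : ∀ k, Continuous (fun x => η k x * (δ k + ‖g x‖)⁻¹) := fun k =>
    ((η k).continuous).mul ((continuous_const.add hgc.norm).inv₀ fun x => (hpos k x).ne')
  have hφcont : ∀ k, Continuous (φ k) := fun k => (hcoef k).smul hgc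
  have hφc : ∀ k, HasCompactSupport (φ k) := fun k =>
    ((η k).hasCompactSupport.mul_right).smul_right
  have hφ1 : ∀ k x, ‖φ k x‖ ≤ 1 := by
    intro k x
    simp only [hφ]
    rw [norm_smul, norm_mul, norm_inv, Real.norm_of_nonneg (hpos k x).le,
      Real.norm_of_nonneg (η k).nonneg, mul_assoc]
    refine mul_le_one₀ (η k).le_one (by have := hpos k x; positivity) ?_
    rw [inv_mul_le_iff₀ (hpos k x)]
    linarith [hδ0 k]
  have hval : ∀ k x, fderiv ℝ (mol E ρ) x (φ k x) = η k x * ((δ k + ‖g x‖)⁻¹ * ‖g x‖ ^ 2) := by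
    intro k x
    rw [hgi, hφ, inner_smul_right, real_inner_self_eq_norm_sq, mul_assoc]
  have hnn : ∀ k x, 0 ≤ fderiv ℝ (mol E ρ) x (φ k x) := by
    intro k x
    rw [hval]
    have := hpos k x
    have := (η k).nonneg (x := x)
    positivity
  have hcont : ∀ k, Continuous (fun x => fderiv ℝ (mol E ρ) x (φ k x)) := fun k => by
    simp_rw [hgi]; exact hgc.inner (hφcont k)
  refine fatou_bound (fun k x => ENNReal.ofReal (fderiv ℝ (mol E ρ) x (φ k x))) _ _
    (fun k => (hcont k).measurable.ennreal_ofReal) (Eventually.of_forall fun x => ?_) (fun k => ?_)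
  · refine ENNReal.tendsto_ofReal ?_
    simp_rw [hval]
    have hη : Tendsto (fun k => η k x) atTop (𝓝 1) := by
      refine tendsto_const_nhds.congr' ?_
      obtain ⟨N, hN⟩ := exists_nat_ge ‖x‖
      filter_upwards [eventually_ge_atTop N] with k hk
      refine ((η k).one_of_mem_closedBall ?_).symm
      rw [mem_closedBall_zero_iff]
      have : (N : ℝ) ≤ k := by exact_mod_cast hk
      show ‖x‖ ≤ (k : ℝ) + 1
      linarith
    have hδl : Tendsto δ atTop (𝓝 0) := tendsto_one_div_add_atTop_nhds_zero_nat
    have h2 : Tendsto (fun k => (δ k + ‖g x‖)⁻¹ * ‖g x‖ ^ 2) atTop (𝓝 ‖g x‖) := by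
      by_cases h0 : ‖g x‖ = 0
      · simp [h0]
      · have h3 := ((hδl.add_const ‖g x‖).inv₀ (by simpa using h0)).mul_const (‖g x‖ ^ 2)
        have h4 : (0 + ‖g x‖)⁻¹ * ‖g x‖ ^ 2 = ‖g x‖ := by
          rw [zero_add]; field_simp
        rwa [h4] at h3
    simpa using hη.mul h2
  · rw [← ofReal_integral_eq_lintegral_ofReal]
    · exact mol_test hE hρ hc heven hρ0 hρ1 (hφcont k) (hφc k) (hφ1 k)
    · refine (hcont k).integrable_of_hasCompactSupport ?_
      refine (hφc k).mono fun x hx h0 => hx ?_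
      simp [h0]
    · exact Eventually.of_forall (hnn k)

lemma diff_bound {n : ℕ} {u : V n → ℝ} (hu : ContDiff ℝ 1 u) (z : V n) :
    ∫⁻ x, ENNReal.ofReal (u x - u (x - z)) ≤ ∫⁻ x, ENNReal.ofReal (fderiv ℝ u x z) := by
  have hdc := hu.continuous_fderiv (by simp)
  have hcz : Continuous fun x => fderiv ℝ u x z := hdc.clm_apply continuous_const
  have h1 : ∀ x, ENNReal.ofReal (u x - u (x - z)) ≤
      ∫⁻ t in Set.Ioc (0 : ℝ) 1, ENNReal.ofReal (fderiv ℝ u (x - z + t • z) z) := by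
    intro x
    have hd : ∀ t : ℝ, HasDerivAt (fun t : ℝ => u (x - z + t • z)) (fderiv ℝ u (x - z + t • z) z) t := by
      intro t
      have h2 : HasDerivAt (fun t : ℝ => x - z + t • z) z t := by
        simpa using ((hasDerivAt_id t).smul_const z).const_add (x - z)
      exact ((hu.differentiable (by simp)) _).hasFDerivAt.comp_hasDerivAt t h2
    have hcont : Continuous fun t : ℝ => fderiv ℝ u (x - z + t • z) z := hcz.comp (by fun_prop)
    have h3 := intervalIntegral.integral_eq_sub_of_hasDerivAt (a := 0) (b := 1) (fun t _ => hd t)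
      (hcont.intervalIntegrable 0 1)
    have h4 : u x - u (x - z) = ∫ t in Set.Ioc (0:ℝ) 1, fderiv ℝ u (x - z + t • z) z := by
      rw [← intervalIntegral.integral_of_le zero_le_one, h3]; simp
    rw [h4]
    have hii : IntegrableOn (fun t : ℝ => fderiv ℝ u (x - z + t • z) z) (Set.Ioc 0 1) :=
      (hcont.intervalIntegrable 0 1).1
    have h5 : ∫ t in Set.Ioc (0:ℝ) 1, fderiv ℝ u (x - z + t • z) z ≤
        ∫ t in Set.Ioc (0:ℝ) 1, max (fderiv ℝ u (x - z + t • z) z) 0 :=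
      integral_mono hii hii.pos_part (fun t => le_max_left _ _)
    refine (ENNReal.ofReal_le_ofReal h5).trans ?_
    rw [ofReal_integral_eq_lintegral_ofReal hii.pos_part (Eventually.of_forall fun t => le_max_right _ _)]
    refine lintegral_mono fun t => ?_
    rcases le_total (fderiv ℝ u (x - z + t • z) z) 0 with h | h <;> simp [h]
  calc _ ≤ ∫⁻ x, ∫⁻ t in Set.Ioc (0 : ℝ) 1, ENNReal.ofReal (fderiv ℝ u (x - z + t • z) z) :=
        lintegral_mono h1
    _ = ∫⁻ t in Set.Ioc (0 : ℝ) 1, ∫⁻ x, ENNReal.ofReal (fderiv ℝ u (x - z + t • z) z) := by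
        refine lintegral_lintegral_swap ?_
        refine Measurable.aemeasurable ?_
        refine (Continuous.measurable ?_).ennreal_ofReal
        exact hcz.comp (by fun_prop)
    _ = ∫⁻ t in Set.Ioc (0 : ℝ) 1, ∫⁻ x, ENNReal.ofReal (fderiv ℝ u x z) := by
        refine lintegral_congr fun t => ?_
        have := lintegral_add_right_eq_self (μ := (volume : Measure (V n)))
          (fun x => ENNReal.ofReal (fderiv ℝ u x z)) (- z + t • z)
        rw [← this]
        refine lintegral_congr fun x => ?_
        rw [sub_eq_add_neg, add_assoc]
    _ = _ := by simp

lemma mol_bound {n : ℕ} (hn : 1 ≤ n) {G : V n → ℝ} (hG : H12 G)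
    {E : Set (V n)} (hE : MeasurableSet E) {ρ : V n → ℝ}
    (hρ : ContDiff ℝ 1 ρ) (hc : HasCompactSupport ρ) (heven : ∀ x, ρ (-x) = ρ x)
    (hρ0 : ∀ x, 0 ≤ ρ x) (hρ1 : ∫ x, ρ x = 1) :
    ∫⁻ z, ∫⁻ x, ENNReal.ofReal (G z) * ENNReal.ofReal (mol E ρ x - mol E ρ (x - z)) ≤ perimeter E := by
  set u := mol E ρ with hu_def
  have hu : ContDiff ℝ 1 u := mol_contDiff hE hρ hc
  have hgc : Continuous (gradient u) :=
    (InnerProductSpace.toDual ℝ (V n)).symm.continuous.comp (hu.continuous_fderiv (by simp))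
  have hgi : ∀ x h, fderiv ℝ u x h = inner ℝ (gradient u x) h := by
    intro x h
    rw [gradient, InnerProductSpace.toDual_symm_apply]
  have hGm : Measurable (fun z => ENNReal.ofReal (G z)) := hG.measurable.ennreal_ofReal
  calc _ ≤ ∫⁻ z, ∫⁻ x, ENNReal.ofReal (G z) * ENNReal.ofReal (inner ℝ (gradient u x) z) := by
        refine lintegral_mono fun z => ?_
        have hcu := hu.continuous
        rw [lintegral_const_mul _ (by fun_prop), lintegral_const_mul _ (by fun_prop)]
        refine mul_le_mul_right (α := ℝ≥0∞) ?_ _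
        have := diff_bound hu z
        simp_rw [hgi] at this
        exact this
    _ = ∫⁻ x, ∫⁻ z, ENNReal.ofReal (G z) * ENNReal.ofReal (inner ℝ (gradient u x) z) := by
        refine lintegral_lintegral_swap (Measurable.aemeasurable ?_)
        have hGm' := hG.measurable
        unfold Function.uncurry
        fun_prop
    _ = ∫⁻ x, ENNReal.ofReal ‖gradient u x‖ := lintegral_congr fun x => const_eq_one hn G hG _
    _ ≤ perimeter E := mol_tv hE hρ hc heven hρ0 hρ1

/-- For any set of finite perimeter `E`, `Per_G(E) ≤ P(E)`. -/
theorem statement9 (n : ℕ) (hn : 2 ≤ n) (G : V n → ℝ) (hG : H12 G)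
    (E : Set (V n)) (hE : HasFinitePerimeter E) :
    PerGe G E ≤ perimeter E := by
  have hEm := hE.1
  have hGm' := hG.measurable
  have hGm : Measurable (fun z => ENNReal.ofReal (G z)) := hG.measurable.ennreal_ofReal
  set χ : V n → ℝ := E.indicator (fun _ => (1 : ℝ)) with hχ
  have hχm : Measurable χ := measurable_const.indicator hEm
  have h1 : PerGe G E = ∫⁻ z, ∫⁻ x, ENNReal.ofReal (G z) * ENNReal.ofReal (χ x - χ (x - z)) := by
    have hm : Measurable fun p : V n × V n => ENNReal.ofReal (G p.2) * ENNReal.ofReal (χ p.1 - χ (p.1 - p.2)) := by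
      fun_prop
    rw [lintegral_lintegral_swap (f := fun z x => ENNReal.ofReal (G z) * ENNReal.ofReal (χ x - χ (x - z)))
      (hm.comp measurable_swap).aemeasurable]
    unfold PerGe
    rw [← lintegral_indicator hEm]
    refine lintegral_congr fun x => ?_
    by_cases hx : x ∈ E
    · rw [Set.indicator_of_mem hx, ← lintegral_indicator hEm.compl,
        ← lintegral_sub_left_eq_self _ x]
      refine lintegral_congr fun z => ?_
      by_cases hz : x - z ∈ E <;> simp [hx, hz, hχ]
    · rw [Set.indicator_of_notMem hx]
      symm
      rw [lintegral_eq_zero_iff (by fun_prop)]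
      refine Eventually.of_forall fun z => ?_
      by_cases hz : x - z ∈ E <;> simp [hx, hz, hχ]
  rw [h1]
  let B : ℕ → ContDiffBump (0 : V n) := fun k =>
    ⟨1 / ((k : ℝ) + 1), 2 / ((k : ℝ) + 1), by positivity, by gcongr; norm_num⟩
  set ρ : ℕ → V n → ℝ := fun k => (B k).normed volume with hρdef
  have hρ : ∀ k, ContDiff ℝ 1 (ρ k) := fun k => (B k).contDiff_normed
  have hc : ∀ k, HasCompactSupport (ρ k) := fun k => (B k).hasCompactSupport_normed
  have hae : ∀ᵐ x : V n, Tendsto (fun k => mol E (ρ k) x) atTop (𝓝 (χ x)) := by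
    have h := ContDiffBump.ae_convolution_tendsto_right_of_locallyIntegrable (μ := (volume : Measure (V n)))
      (φ := B) (l := atTop) (K := 2) (g := χ) ?_ ?_ (locInt_ind hEm)
    · filter_upwards [h] with x hx
      refine hx.congr fun k => ?_
      rw [mol, ← convolution_flip]
      congr 1
      ext
      simp
    · show Tendsto (fun k : ℕ => 2 / ((k : ℝ) + 1)) atTop (𝓝 0)
      have := (tendsto_one_div_add_atTop_nhds_zero_nat (𝕜 := ℝ)).const_mul 2
      simpa [div_eq_mul_inv] using this
    · refine Eventually.of_forall fun k => ?_
      show 2 / ((k : ℝ) + 1) ≤ 2 * (1 / ((k : ℝ) + 1))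
      rw [mul_one_div]
  have hcu : ∀ k, Continuous (mol E (ρ k)) := fun k => (mol_contDiff hEm (hρ k) (hc k)).continuous
  have hmk : ∀ k, Measurable fun p : V n × V n => ENNReal.ofReal (G p.1) *
      ENNReal.ofReal (mol E (ρ k) p.2 - mol E (ρ k) (p.2 - p.1)) := by
    intro k
    have := (hcu k).measurable
    fun_prop
  have hm0 : Measurable fun p : V n × V n => ENNReal.ofReal (G p.1) *
      ENNReal.ofReal (χ p.2 - χ (p.2 - p.1)) := by
    fun_prop
  rw [lintegral_lintegral hm0.aemeasurable]
  refine fatou_bound (fun k (p : V n × V n) => ENNReal.ofReal (G p.1) *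
      ENNReal.ofReal (mol E (ρ k) p.2 - mol E (ρ k) (p.2 - p.1))) _ _ hmk ?_ ?_
  · have hA : ∀ᵐ p : V n × V n ∂(volume.prod volume), Tendsto (fun k => mol E (ρ k) p.2) atTop (𝓝 (χ p.2)) :=
      Measure.quasiMeasurePreserving_snd.ae hae
    have hB : ∀ᵐ p : V n × V n ∂(volume.prod volume),
        Tendsto (fun k => mol E (ρ k) (p.2 - p.1)) atTop (𝓝 (χ (p.2 - p.1))) :=
      by
      have hq := Measure.quasiMeasurePreserving_snd.comp (measurePreserving_prod_neg_add
        (volume : Measure (V n)) (volume : Measure (V n))).quasiMeasurePreserving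
      filter_upwards [hq.ae hae] with p hp
      simpa [neg_add_eq_sub] using hp
    filter_upwards [hA, hB] with p hp1 hp2
    exact ENNReal.Tendsto.const_mul (ENNReal.tendsto_ofReal (hp1.sub hp2)) (Or.inr ENNReal.ofReal_ne_top)
  · intro k
    rw [← lintegral_lintegral (f := fun z x => ENNReal.ofReal (G z) *
      ENNReal.ofReal (mol E (ρ k) x - mol E (ρ k) (x - z))) (hmk k).aemeasurable]
    refine mol_bound (by omega) hG hEm (hρ k) (hc k) (fun x => (B k).normed_neg x)
      (fun x => (B k).nonneg_normed x) (B k).integral_normed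
end
end

section
/- Let n ≥ 2 and let (η_ε)_{ε>0} be an (n−1)-dimensional approximation of identity; if n = 2, assume in addition that for every R ∈ (0,2), sup_{r>R} η_ε(r) → 0 as ε → 0. Then Q(η_ε) → 1 as ε → 0, where Q(η) := |S^{n−2}| ∫₀^π (θ/2)² (sin θ)^{n−2} (sin(θ/2))^{−2} η(2 sin(θ/2)) dθ. -/
open MeasureTheory Metric Filter Asymptotics ENNReal
open scoped ENNReal NNReal Topology

noncomputable section

/-- A `k`-dimensional approximation of identity. -/
def ApproxId (k : ℕ) (ρ : ℝ → ℝ → ℝ) : Prop :=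
  (∀ ε : ℝ, 0 < ε → Measurable (ρ ε)) ∧
  (∀ ε : ℝ, 0 < ε → ∀ r : ℝ, 0 < r → 0 ≤ ρ ε r) ∧
  (∀ ε : ℝ, 0 < ε →
    (μH[(k : ℝ) - 1] (sphere (0 : V k) 1)).toReal *
      ∫ r in Set.Ioi (0 : ℝ), ρ ε r * r ^ (k - 1) = 1) ∧
  (∀ δ : ℝ, 0 < δ →
    Tendsto (fun ε : ℝ => ∫ r in Set.Ioi δ, ρ ε r * r ^ (k - 1)) (𝓝[>] 0) (𝓝 0))


/-- The quantity `Q(η)`. -/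
def Qreal (n : ℕ) (η : ℝ → ℝ) : ℝ :=
  (μH[(n : ℝ) - 2] (sphere (0 : V (n - 1)) 1)).toReal *
    ∫ θ in Set.Ioo (0 : ℝ) Real.pi,
      (θ / 2) ^ 2 * Real.sin θ ^ (n - 2) / Real.sin (θ / 2) ^ 2 * η (2 * Real.sin (θ / 2))

def chord (θ : ℝ) : ℝ := 2 * Real.sin (θ / 2)

def integrandF (m : ℕ) (η : ℝ → ℝ) (θ : ℝ) : ℝ :=
  (θ / 2) ^ 2 * Real.sin θ ^ m / Real.sin (θ / 2) ^ 2 * η (2 * Real.sin (θ / 2))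

def integrandG (m : ℕ) (η : ℝ → ℝ) (r : ℝ) : ℝ := η r * r ^ m

def integrandH (m : ℕ) (η : ℝ → ℝ) (θ : ℝ) : ℝ :=
  Real.cos (θ / 2) * integrandG m η (chord θ)

def weightW (m : ℕ) (θ : ℝ) : ℝ :=
  (Real.sinc (θ / 2) ^ 2)⁻¹ * (Real.cos (θ / 2) ^ m * (Real.cos (θ / 2))⁻¹)

lemma chord_strictMono : StrictMonoOn chord (Set.Icc 0 Real.pi) := by
  intro x hx y hy hxy
  have := Real.strictMonoOn_sin (a := x / 2) (b := y / 2)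
    ⟨by linarith [hx.1, Real.pi_pos], by linarith [hx.2]⟩
    ⟨by linarith [hy.1, Real.pi_pos], by linarith [hy.2]⟩ (by linarith)
  unfold chord; linarith

lemma chord_continuous : Continuous chord := by unfold chord; fun_prop

lemma chord_image {a b : ℝ} (ha : 0 ≤ a) (hab : a < b) (hb : b ≤ Real.pi) :
    chord '' Set.Ioo a b = Set.Ioo (chord a) (chord b) := by
  apply Set.Subset.antisymm
  · rintro _ ⟨x, hx, rfl⟩
    have h1 : a ∈ Set.Icc 0 Real.pi := ⟨ha, by linarith⟩
    have h2 : b ∈ Set.Icc 0 Real.pi := ⟨by linarith, hb⟩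
    have h3 : x ∈ Set.Icc 0 Real.pi := ⟨by linarith [hx.1], by linarith [hx.2]⟩
    exact ⟨chord_strictMono h1 h3 hx.1, chord_strictMono h3 h2 hx.2⟩
  · exact intermediate_value_Ioo hab.le chord_continuous.continuousOn

lemma cos_half_pos {θ : ℝ} (h0 : 0 < θ) (h1 : θ < Real.pi) : 0 < Real.cos (θ / 2) :=
  Real.cos_pos_of_mem_Ioo ⟨by linarith [Real.pi_pos], by linarith⟩

lemma sin_half_pos {θ : ℝ} (h0 : 0 < θ) (h1 : θ < Real.pi) : 0 < Real.sin (θ / 2) :=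
  Real.sin_pos_of_pos_of_lt_pi (by linarith) (by linarith)

lemma change_var (m : ℕ) (η : ℝ → ℝ) {a b : ℝ} (ha : 0 ≤ a) (hab : a < b) (hb : b ≤ Real.pi)
    (hg : IntegrableOn (integrandG m η) (Set.Ioi 0)) :
    IntegrableOn (integrandH m η) (Set.Ioo a b) ∧
      ∫ θ in Set.Ioo a b, integrandH m η θ =
        ∫ r in Set.Ioo (chord a) (chord b), integrandG m η r := by
  have hd : ∀ x ∈ Set.Ioo a b, HasDerivWithinAt chord (Real.cos (x / 2)) (Set.Ioo a b) x := by
    intro x _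
    have h := ((Real.hasDerivAt_sin (x / 2)).comp x ((hasDerivAt_id x).div_const 2)).const_mul 2
    refine HasDerivAt.hasDerivWithinAt ?_
    have e : 2 * (Real.cos (x / 2) * (1 / 2)) = Real.cos (x / 2) := by ring
    rw [← e]
    exact h
  have hinj : Set.InjOn chord (Set.Ioo a b) :=
    
    chord_strictMono.injOn.mono
      ((Set.Ioo_subset_Icc_self).trans (Set.Icc_subset_Icc ha hb))
  have hca : 0 ≤ chord a := by
    unfold chord
    have := Real.sin_nonneg_of_nonneg_of_le_pi (x := a / 2) (by linarith) (by linarith)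
    linarith
  have hEq : Set.EqOn (fun x => |Real.cos (x / 2)| • integrandG m η (chord x))
      (integrandH m η) (Set.Ioo a b) := by
    intro x hx
    have := cos_half_pos (θ := x) (by linarith [hx.1]) (by linarith [hx.2])
    simp [integrandH, abs_of_pos this]
  constructor
  · rw [← integrableOn_congr_fun hEq measurableSet_Ioo,
      ← integrableOn_image_iff_integrableOn_abs_deriv_smul measurableSet_Ioo hd hinj,
      chord_image ha hab hb]
    exact hg.mono_set fun x hx => lt_of_le_of_lt hca hx.1
  · rw [← setIntegral_congr_fun measurableSet_Ioo hEq,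
      ← integral_image_eq_integral_abs_deriv_smul measurableSet_Ioo hd hinj,
      chord_image ha hab hb]

lemma F_eq (m : ℕ) (η : ℝ → ℝ) {θ : ℝ} (h0 : 0 < θ) (h1 : θ < Real.pi) :
    integrandF m η θ = weightW m θ * integrandH m η θ := by
  have hc := cos_half_pos h0 h1
  have hs := sin_half_pos h0 h1
  have e : Real.sin θ = 2 * Real.sin (θ / 2) * Real.cos (θ / 2) := by
    rw [← Real.sin_two_mul]; congr 1; ring
  unfold integrandF weightW integrandH integrandG chord
  rw [e, Real.sinc_of_ne_zero (by linarith : θ / 2 ≠ 0), mul_pow]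
  field_simp

lemma sincsq_bound {θ : ℝ} (h0 : 0 < θ) (h1 : θ < Real.pi) :
    (Real.sinc (θ / 2) ^ 2)⁻¹ ≤ (Real.pi / 2) ^ 2 := by
  have h := Real.mul_le_sin (x := θ / 2) (by linarith) (by linarith)
  have hp := Real.pi_pos
  rw [Real.sinc_of_ne_zero (by linarith : θ / 2 ≠ 0)]
  have h2 : 2 / Real.pi ≤ Real.sin (θ / 2) / (θ / 2) := by
    rw [le_div_iff₀ (by linarith)]; exact h
  have h3 : (Real.pi / 2) ^ 2 = ((2 / Real.pi) ^ 2)⁻¹ := by field_simp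
  rw [h3]
  gcongr

lemma weightW_measurable (m : ℕ) : Measurable (weightW m) := by
  have := Real.continuous_sinc.measurable
  unfold weightW
  fun_prop

lemma weightW_near (m : ℕ) {e : ℝ} (he : 0 < e) :
    ∃ δ, 0 < δ ∧ δ < Real.pi ∧ ∀ θ ∈ Set.Ioo 0 δ, |weightW m θ - 1| ≤ e := by
  have hc : ContinuousAt (weightW m) 0 := by
    have h1 : ContinuousAt (fun θ : ℝ => Real.sinc (θ / 2)) 0 :=
      (Real.continuous_sinc.comp (continuous_id.div_const 2)).continuousAt
    have h2 : ContinuousAt (fun θ : ℝ => Real.cos (θ / 2)) 0 := by fun_prop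
    exact ((h1.pow 2).inv₀ (by simp)).mul ((h2.pow m).mul (h2.inv₀ (by simp)))
  have h0 : weightW m 0 = 1 := by simp [weightW]
  obtain ⟨d, hd, H⟩ := Metric.continuousAt_iff.1 hc e he
  refine ⟨min d 1, by positivity, ?_, ?_⟩
  · have := Real.pi_gt_three
    linarith [min_le_right d 1]
  · intro θ hθ
    have : dist θ 0 < d := by
      rw [Real.dist_eq, sub_zero, abs_of_pos hθ.1]; exact lt_of_lt_of_le hθ.2 (min_le_left _ _)
    have := H this
    rw [h0, Real.dist_eq] at this
    exact this.le

lemma H_nonneg (m : ℕ) (η : ℝ → ℝ) (hη : ∀ r, 0 < r → 0 ≤ η r) {θ : ℝ} (h0 : 0 < θ)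
    (h1 : θ < Real.pi) : 0 ≤ integrandH m η θ := by
  have hc := cos_half_pos h0 h1
  have hs := sin_half_pos h0 h1
  have : 0 < chord θ := by unfold chord; linarith
  have := hη _ this
  unfold integrandH integrandG
  positivity

lemma F_measurable (m : ℕ) {η : ℝ → ℝ} (hη : Measurable η) : Measurable (integrandF m η) := by
  unfold integrandF
  fun_prop

lemma chord_pos {θ : ℝ} (h0 : 0 < θ) (h1 : θ < Real.pi) : 0 < chord θ := by
  have hs := sin_half_pos h0 h1
  unfold chord; linarith

/-- Near part. -/
lemma near_bound (m : ℕ) (η : ℝ → ℝ) (hpos : ∀ r, 0 < r → 0 ≤ η r)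
    (hg : IntegrableOn (integrandG m η) (Set.Ioi 0)) {δ e : ℝ} (hδ : 0 < δ) (hδ' : δ < Real.pi)
    (hW : ∀ θ ∈ Set.Ioo 0 δ, |weightW m θ - 1| ≤ e) :
    IntegrableOn (integrandF m η) (Set.Ioo 0 δ) ∧
    |(∫ θ in Set.Ioo 0 δ, integrandF m η θ) - ∫ θ in Set.Ioo 0 δ, integrandH m η θ| ≤
      e * ∫ θ in Set.Ioo 0 δ, integrandH m η θ := by
  have hH := (change_var m η le_rfl hδ hδ'.le hg).1
  have hD : IntegrableOn (fun θ => (weightW m θ - 1) * integrandH m η θ) (Set.Ioo 0 δ) := by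
    refine Integrable.bdd_mul (c := e) hH
      ((weightW_measurable m).sub_const 1).aestronglyMeasurable ?_
    filter_upwards [ae_restrict_mem measurableSet_Ioo] with θ hθ
    exact hW θ hθ
  have hEq : Set.EqOn (fun θ => (weightW m θ - 1) * integrandH m η θ + integrandH m η θ)
      (integrandF m η) (Set.Ioo 0 δ) := by
    intro θ hθ
    simp only
    rw [F_eq m η hθ.1 (hθ.2.trans hδ')]; ring
  have hF : IntegrableOn (integrandF m η) (Set.Ioo 0 δ) :=
    (integrableOn_congr_fun hEq measurableSet_Ioo).1 (Integrable.add hD hH)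
  refine ⟨hF, ?_⟩
  rw [← setIntegral_congr_fun measurableSet_Ioo hEq, integral_add hD hH, add_sub_cancel_right,
    ← integral_const_mul, ← Real.norm_eq_abs]
  refine norm_integral_le_of_norm_le (hH.const_mul e) ?_
  filter_upwards [ae_restrict_mem measurableSet_Ioo] with θ hθ
  have hn := H_nonneg m η hpos hθ.1 (hθ.2.trans hδ')
  rw [Real.norm_eq_abs, abs_mul, abs_of_nonneg hn]
  exact mul_le_mul_of_nonneg_right (hW θ hθ) hn

/-- Far part, dimension at least three. -/
lemma far_bound_pos (m : ℕ) (η : ℝ → ℝ) (hpos : ∀ r, 0 < r → 0 ≤ η r)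
    (hg : IntegrableOn (integrandG (m + 1) η) (Set.Ioi 0)) {δ : ℝ} (hδ : 0 < δ)
    (hδ' : δ < Real.pi) :
    IntegrableOn (integrandF (m + 1) η) (Set.Ioo δ Real.pi) ∧
    |∫ θ in Set.Ioo δ Real.pi, integrandF (m + 1) η θ| ≤
      (Real.pi / 2) ^ 2 * ∫ r in Set.Ioi (chord δ), integrandG (m + 1) η r := by
  obtain ⟨hH, hHe⟩ := change_var (m + 1) η hδ.le hδ' le_rfl hg
  have hWb : ∀ θ ∈ Set.Ioo δ Real.pi, |weightW (m + 1) θ| ≤ (Real.pi / 2) ^ 2 := by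
    intro θ hθ
    have h0 := hδ.trans hθ.1
    have hc := cos_half_pos h0 hθ.2
    have hb := sincsq_bound h0 hθ.2
    have e1 : weightW (m + 1) θ = (Real.sinc (θ / 2) ^ 2)⁻¹ * Real.cos (θ / 2) ^ m := by
      unfold weightW
      rw [pow_succ (Real.cos (θ / 2)) m, mul_assoc (Real.cos (θ / 2) ^ m), mul_inv_cancel₀ hc.ne', mul_one]
    rw [e1, abs_of_nonneg (by positivity)]
    have := pow_le_one₀ (n := m) hc.le (Real.cos_le_one _)
    calc _ ≤ (Real.pi / 2) ^ 2 * 1 := by gcongr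
      _ = _ := mul_one _
  have hEq : Set.EqOn (fun θ => weightW (m + 1) θ * integrandH (m + 1) η θ)
      (integrandF (m + 1) η) (Set.Ioo δ Real.pi) := by
    intro θ hθ
    exact (F_eq (m + 1) η (hδ.trans hθ.1) hθ.2).symm
  have hD : IntegrableOn (fun θ => weightW (m + 1) θ * integrandH (m + 1) η θ)
      (Set.Ioo δ Real.pi) := by
    refine Integrable.bdd_mul (c := (Real.pi / 2) ^ 2) hH
      (weightW_measurable _).aestronglyMeasurable ?_
    filter_upwards [ae_restrict_mem measurableSet_Ioo] with θ hθ
    exact hWb θ hθ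
  refine ⟨(integrableOn_congr_fun hEq measurableSet_Ioo).1 hD, ?_⟩
  have hcp := chord_pos hδ hδ'
  have hle : ∫ θ in Set.Ioo δ Real.pi, integrandH (m + 1) η θ ≤
      ∫ r in Set.Ioi (chord δ), integrandG (m + 1) η r := by
    rw [hHe]
    refine setIntegral_mono_set (hg.mono_set fun x hx => hcp.trans hx) ?_
      (Set.Ioo_subset_Ioi_self.eventuallyLE)
    filter_upwards [ae_restrict_mem measurableSet_Ioi] with r hr
    have hr0 : 0 < r := hcp.trans hr
    have := hpos r hr0
    simp only [integrandG, Pi.zero_apply]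
    positivity
  refine le_trans ?_ (mul_le_mul_of_nonneg_left hle (by positivity))
  rw [← setIntegral_congr_fun measurableSet_Ioo hEq, ← integral_const_mul, ← Real.norm_eq_abs]
  refine norm_integral_le_of_norm_le (hH.const_mul _) ?_
  filter_upwards [ae_restrict_mem measurableSet_Ioo] with θ hθ
  have hn := H_nonneg (m + 1) η hpos (hδ.trans hθ.1) hθ.2
  rw [Real.norm_eq_abs, abs_mul, abs_of_nonneg hn]
  exact mul_le_mul_of_nonneg_right (hWb θ hθ) hn

/-- Far part, dimension two. -/
lemma far_bound_zero (η : ℝ → ℝ) (hm : Measurable η) (hpos : ∀ r, 0 < r → 0 ≤ η r)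
    {δ e : ℝ} (hδ : 0 < δ) (hδ' : δ < Real.pi)
    (hb : ∀ r, chord δ < r → η r ≤ e) :
    IntegrableOn (integrandF 0 η) (Set.Ioo δ Real.pi) ∧
    |∫ θ in Set.Ioo δ Real.pi, integrandF 0 η θ| ≤ (Real.pi / 2) ^ 2 * e * Real.pi := by
  have he : 0 ≤ e := by
    have h1 := chord_pos hδ hδ'
    exact (hpos (chord δ + 1) (by linarith)).trans (hb _ (by linarith))
  have hF : ∀ θ ∈ Set.Ioo δ Real.pi, ‖integrandF 0 η θ‖ ≤ (Real.pi / 2) ^ 2 * e := by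
    intro θ hθ
    have h0 := hδ.trans hθ.1
    have hs := sin_half_pos h0 hθ.2
    have hq := sincsq_bound h0 hθ.2
    have h1 : chord δ < chord θ :=
      chord_strictMono ⟨hδ.le, hδ'.le⟩ ⟨h0.le, hθ.2.le⟩ hθ.1
    have e1 : integrandF 0 η θ = (Real.sinc (θ / 2) ^ 2)⁻¹ * η (chord θ) := by
      unfold integrandF chord
      rw [Real.sinc_of_ne_zero (by linarith : θ / 2 ≠ 0)]
      field_simp
    have h2 := hpos _ (chord_pos h0 hθ.2)
    have h3 := hb _ h1
    rw [e1, Real.norm_eq_abs, abs_of_nonneg (by positivity)]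
    gcongr
  constructor
  · refine Measure.integrableOn_of_bounded (M := (Real.pi / 2) ^ 2 * e) (by simp)
      (F_measurable 0 hm).aestronglyMeasurable ?_
    filter_upwards [ae_restrict_mem measurableSet_Ioo] with θ hθ
    exact hF θ hθ
  · have h := norm_setIntegral_le_of_norm_le_const (μ := volume) (by simp) hF
    rw [Real.norm_eq_abs] at h
    refine h.trans ?_
    have : volume.real (Set.Ioo δ Real.pi) ≤ Real.pi := by
      rw [Real.volume_real_Ioo_of_le hδ'.le]; linarith
    gcongr

lemma core (m : ℕ) (c : ℝ) (hc : 0 ≤ c) (η : ℝ → ℝ → ℝ)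
    (hm : ∀ ε : ℝ, 0 < ε → Measurable (η ε))
    (hpos : ∀ ε : ℝ, 0 < ε → ∀ r : ℝ, 0 < r → 0 ≤ η ε r)
    (hone : ∀ ε : ℝ, 0 < ε → c * ∫ r in Set.Ioi (0 : ℝ), integrandG m (η ε) r = 1)
    (htail : ∀ δ : ℝ, 0 < δ →
      Tendsto (fun ε : ℝ => ∫ r in Set.Ioi δ, integrandG m (η ε) r) (𝓝[>] 0) (𝓝 0))
    (h2 : m = 0 → ∀ R ∈ Set.Ioo (0 : ℝ) 2,
      Tendsto (fun ε : ℝ => ⨆ r ∈ Set.Ioi R, ENNReal.ofReal (η ε r)) (𝓝[>] 0) (𝓝 0)) :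
    Tendsto (fun ε : ℝ => c * ∫ θ in Set.Ioo 0 Real.pi, integrandF m (η ε) θ)
      (𝓝[>] 0) (𝓝 1) := by
  have hg : ∀ ε : ℝ, 0 < ε → IntegrableOn (integrandG m (η ε)) (Set.Ioi 0) := by
    intro ε hε
    by_contra hcon
    have := hone ε hε
    rw [integral_undef hcon] at this
    simp at this
  have far : ∀ δ : ℝ, 0 < δ → δ < Real.pi → ∀ e : ℝ, 0 < e → ∀ᶠ ε in 𝓝[>] (0 : ℝ),
      IntegrableOn (integrandF m (η ε)) (Set.Ioo δ Real.pi) ∧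
      |∫ θ in Set.Ioo δ Real.pi, integrandF m (η ε) θ| ≤ e := by
    intro δ hδ hδ' e he
    have hcp := chord_pos hδ hδ'
    rcases m with _ | m
    · have hlt : chord δ < 2 := by
        have := chord_strictMono ⟨hδ.le, hδ'.le⟩ ⟨Real.pi_pos.le, le_rfl⟩ hδ'
        simpa [chord] using this
      have hK : 0 < e / ((Real.pi / 2) ^ 2 * Real.pi) := by have := Real.pi_pos; positivity
      have ht := h2 rfl (chord δ) ⟨hcp, hlt⟩
      have hev := (tendsto_order.1 ht).2 _ (ENNReal.ofReal_pos.2 hK)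
      filter_upwards [hev, self_mem_nhdsWithin] with ε h1 hε
      have hb : ∀ r, chord δ < r → η ε r ≤ e / ((Real.pi / 2) ^ 2 * Real.pi) := by
        intro r hr
        have h3 : ENNReal.ofReal (η ε r) ≤ ⨆ r ∈ Set.Ioi (chord δ), ENNReal.ofReal (η ε r) :=
          le_iSup₂ (f := fun r (_ : r ∈ Set.Ioi (chord δ)) => ENNReal.ofReal (η ε r)) r hr
        exact (ENNReal.ofReal_le_ofReal_iff hK.le).1 (h3.trans h1.le)
      obtain ⟨i, j⟩ := far_bound_zero (η ε) (hm ε hε) (hpos ε hε) hδ hδ' hb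
      refine ⟨i, j.trans (le_of_eq ?_)⟩
      have := Real.pi_pos
      field_simp
    · have ht := (htail (chord δ) hcp).const_mul ((Real.pi / 2) ^ 2)
      rw [mul_zero] at ht
      filter_upwards [(tendsto_order.1 ht).2 e he, self_mem_nhdsWithin] with ε h1 hε
      obtain ⟨i, j⟩ := far_bound_pos m (η ε) (hpos ε hε) (hg ε hε) hδ hδ'
      exact ⟨i, j.trans h1.le⟩
  rw [Metric.tendsto_nhds]
  intro e he
  obtain ⟨δ, hδ, hδ', hW⟩ := weightW_near m (e := e / 4) (by positivity)
  have hcp := chord_pos hδ hδ'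
  have ht := (htail (chord δ) hcp).const_mul c
  rw [mul_zero] at ht
  have hc1 : 0 < c + 1 := by linarith
  filter_upwards [(tendsto_order.1 ht).2 (e / 4) (by positivity),
    far δ hδ hδ' (e / 4 / (c + 1)) (by positivity), self_mem_nhdsWithin] with ε h1 h3 hε
  obtain ⟨hFi, hFb⟩ := near_bound m (η ε) (hpos ε hε) (hg ε hε) hδ hδ' hW
  obtain ⟨hH, hHe⟩ := change_var m (η ε) le_rfl hδ hδ'.le (hg ε hε)
  obtain ⟨hFi', hFb'⟩ := h3
  have hsplit : ∫ θ in Set.Ioo 0 Real.pi, integrandF m (η ε) θ =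
      (∫ θ in Set.Ioo 0 δ, integrandF m (η ε) θ) +
        ∫ θ in Set.Ioo δ Real.pi, integrandF m (η ε) θ := by
    rw [← Set.Ioc_union_Ioo_eq_Ioo hδ.le hδ', setIntegral_union ?_ measurableSet_Ioo
      ((integrableOn_Ioc_iff_integrableOn_Ioo (by finiteness)).2 hFi) hFi', integral_Ioc_eq_integral_Ioo]
    exact Set.disjoint_left.2 fun x hx hy => absurd hx.2 (not_le.2 hy.1)
  have hGsplit : ∫ r in Set.Ioi (0 : ℝ), integrandG m (η ε) r =
      (∫ θ in Set.Ioo 0 δ, integrandH m (η ε) θ) +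
        ∫ r in Set.Ioi (chord δ), integrandG m (η ε) r := by
    have h0 : chord 0 = 0 := by simp [chord]
    rw [hHe, h0, ← integral_Ioc_eq_integral_Ioo, ← Set.Ioc_union_Ioi_eq_Ioi hcp.le,
      setIntegral_union ?_ measurableSet_Ioi ((hg ε hε).mono_set Set.Ioc_subset_Ioi_self)
      ((hg ε hε).mono_set fun x hx => hcp.trans hx)]
    exact Set.disjoint_left.2 fun x hx hy => absurd hx.2 (not_le.2 hy)
  have h1' : 0 ≤ ∫ r in Set.Ioi (chord δ), integrandG m (η ε) r := by
    refine setIntegral_nonneg measurableSet_Ioi fun r hr => ?_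
    have hr0 : 0 < r := hcp.trans hr
    have := hpos ε hε r hr0
    simp only [integrandG]
    positivity
  have hone' := hone ε hε
  rw [hGsplit] at hone'
  rw [hsplit, Real.dist_eq]
  generalize (∫ θ in Set.Ioo 0 δ, integrandF m (η ε) θ) = A at *
  generalize (∫ θ in Set.Ioo δ Real.pi, integrandF m (η ε) θ) = B at *
  generalize (∫ r in Set.Ioi (chord δ), integrandG m (η ε) r) = T at *
  generalize (∫ θ in Set.Ioo 0 δ, integrandH m (η ε) θ) = K at *
  have hcT : 0 ≤ c * T := by positivity
  have hcB : c * |B| ≤ e / 4 := by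
    calc c * |B| ≤ (c + 1) * (e / 4 / (c + 1)) := by gcongr; linarith
      _ = e / 4 := by field_simp
  have hcA : c * |A - K| ≤ e / 4 := by
    calc c * |A - K| ≤ c * (e / 4 * K) := by gcongr
      _ = e / 4 * (c * K) := by ring
      _ ≤ e / 4 * 1 := by gcongr; linarith
      _ = e / 4 := mul_one _
  have e1 : c * (A + B) - 1 = c * (A - K) + c * B - c * T := by linear_combination hone'
  have a1 : |c * (A - K)| ≤ e / 4 := by rwa [abs_mul, abs_of_nonneg hc]
  have a2 : |c * B| ≤ e / 4 := by rwa [abs_mul, abs_of_nonneg hc]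
  rw [e1, abs_lt]
  rw [abs_le] at a1 a2
  constructor <;> linarith [a1.1, a1.2, a2.1, a2.2]

/-- For an `(n-1)`-dimensional approximation of identity (with, in
dimension `2`, uniformly vanishing tails), `Q(η_ε) → 1` as `ε → 0`. -/
theorem statement18 (n : ℕ) (hn : 2 ≤ n) (η : ℝ → ℝ → ℝ) (hη : ApproxId (n - 1) η)
    (h2 : n = 2 → ∀ R ∈ Set.Ioo (0 : ℝ) 2,
      Tendsto (fun ε : ℝ => ⨆ r ∈ Set.Ioi R, ENNReal.ofReal (η ε r)) (𝓝[>] 0) (𝓝 0)) :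
    Tendsto (fun ε : ℝ => Qreal n (η ε)) (𝓝[>] 0) (𝓝 1) := by
  obtain ⟨m, rfl⟩ : ∃ m, n = m + 2 := ⟨n - 2, by omega⟩
  obtain ⟨hm, hpos, hone, htail⟩ := hη
  have e1 : m + 2 - 1 = m + 1 := by omega
  have e2 : (((m + 2 - 1 : ℕ) : ℝ) - 1) = ((m + 2 : ℕ) : ℝ) - 2 := by
    rw [e1]; push_cast; ring
  rw [e2] at hone
  exact core m _ ENNReal.toReal_nonneg η hm hpos hone htail (fun h => h2 (by omega))
end
end
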